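/- arXiv:1705.01269 — 3 statements merged into one kernel-verified Lean document; each statement's English description precedes it below -/
import Mathlib

section
/- Let k = r + s ≥ 3 be odd with r ≥ 1, s ≥ 2. Then ζ(r̄, s) = -(1/2)ζ(k̄) + ((1+(-1)^s)/2)ζ(r̄)ζ(s) + (-1)^r Σ_{l=0}^{(k-1)/2} [C(k-2l-1, r-1)ζ(overline{k-2l}) + C(k-2l-1, s-1)ζ(k-2l)] ζ(2l̄), where ζ(0) = ζ(0̄) = -1/2 by convention. -/
open Filter Finset Real

/-- `zeta k` : the Riemann zeta value `ζ(k) = Σ_{m≥1} 1/m^k`, with the convention `ζ(0) = -1/2`. -/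
noncomputable def zeta (k : ℕ) : ℝ :=
  if k = 0 then -1/2 else limUnder atTop (fun N => ∑ m ∈ Finset.range N, 1/((m+1 : ℝ))^k)

/-- `zetaA k` : the alternating zeta value `ζ(k̄) = Σ_{m≥1} (-1)^m/m^k`,
with the convention `ζ(0̄) = -1/2`. -/
noncomputable def zetaA (k : ℕ) : ℝ :=
  if k = 0 then -1/2 else
    limUnder atTop (fun N => ∑ m ∈ Finset.range N, (-1 : ℝ)^(m+1)/((m+1 : ℝ))^k)

/-- `dzeta r s = ζ(r,s) = Σ_{m≥2} (1/m^s) Σ_{j=1}^{m-1} 1/j^r`. -/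
noncomputable def dzeta (r s : ℕ) : ℝ :=
  limUnder atTop (fun N => ∑ m ∈ Finset.range N,
    (1/((m+2 : ℝ))^s) * ∑ j ∈ Finset.range (m+1), 1/((j+1 : ℝ))^r)

/-- `dzetaA1 r s = ζ(r̄,s) = Σ_{m≥2} (1/m^s) Σ_{j=1}^{m-1} (-1)^j/j^r`. -/
noncomputable def dzetaA1 (r s : ℕ) : ℝ :=
  limUnder atTop (fun N => ∑ m ∈ Finset.range N,
    (1/((m+2 : ℝ))^s) * ∑ j ∈ Finset.range (m+1), (-1 : ℝ)^(j+1)/((j+1 : ℝ))^r)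

/-- `dzetaA2 r s = ζ(r,s̄) = Σ_{m≥2} ((-1)^m/m^s) Σ_{j=1}^{m-1} 1/j^r`. -/
noncomputable def dzetaA2 (r s : ℕ) : ℝ :=
  limUnder atTop (fun N => ∑ m ∈ Finset.range N,
    ((-1 : ℝ)^(m+2)/((m+2 : ℝ))^s) * ∑ j ∈ Finset.range (m+1), 1/((j+1 : ℝ))^r)

/-- `dzetaA3 r s = ζ(r̄,s̄) = Σ_{m≥2} ((-1)^m/m^s) Σ_{j=1}^{m-1} (-1)^j/j^r`. -/
noncomputable def dzetaA3 (r s : ℕ) : ℝ :=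
  limUnder atTop (fun N => ∑ m ∈ Finset.range N,
    ((-1 : ℝ)^(m+2)/((m+2 : ℝ))^s) * ∑ j ∈ Finset.range (m+1), (-1 : ℝ)^(j+1)/((j+1 : ℝ))^r)

/-- The partial sums of `ζ(s)`. -/
noncomputable def harmonicPow (s N : ℕ) : ℝ :=
  ∑ m ∈ Finset.range N, ((m : ℝ) + 1)⁻¹ ^ s

/-- The partial sums of `ζ(r̄)`. -/
noncomputable def altHarmonicPow (r N : ℕ) : ℝ :=
  ∑ m ∈ Finset.range N, (-1 : ℝ) ^ (m + 1) * ((m : ℝ) + 1)⁻¹ ^ r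

theorem inv_succ_pow_le {i : ℕ} (hi : 1 ≤ i) (m : ℕ) :
    ((m : ℝ) + 1)⁻¹ ^ i ≤ ((m : ℝ) + 1)⁻¹ :=
  pow_le_of_le_one (by positivity) (inv_le_one_of_one_le₀ (by simp)) (by lia)

theorem antitone_inv_succ_pow (i : ℕ) : Antitone fun m : ℕ => ((m : ℝ) + 1)⁻¹ ^ i := by
  intro a b h
  dsimp only
  gcongr

theorem tendsto_inv_succ_pow {i : ℕ} (hi : 1 ≤ i) :
    Tendsto (fun m : ℕ => ((m : ℝ) + 1)⁻¹ ^ i) atTop (nhds 0) := by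
  have h := (tendsto_one_div_add_atTop_nhds_zero_nat (𝕜 := ℝ)).pow i
  simpa [zero_pow (show i ≠ 0 by lia)] using h

theorem tendsto_altHarmonicPow {r : ℕ} (hr : 1 ≤ r) :
    Tendsto (altHarmonicPow r) atTop (nhds (zetaA r)) := by
  obtain ⟨l, hl⟩ := (antitone_inv_succ_pow r).tendsto_alternating_series_of_tendsto_zero
    (tendsto_inv_succ_pow hr)
  have h : Tendsto (altHarmonicPow r) atTop (nhds (-l)) := by
    refine hl.neg.congr fun N => ?_
    rw [altHarmonicPow, ← Finset.sum_neg_distrib]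
    exact Finset.sum_congr rfl fun m _ => by ring
  have hz : zetaA r = -l := by
    rw [zetaA, if_neg (by lia)]
    refine (h.congr fun N => ?_).limUnder_eq
    exact Finset.sum_congr rfl fun m _ => by rw [inv_pow, div_eq_mul_inv]
  rwa [hz]

theorem tendsto_harmonicPow {s : ℕ} (hs : 2 ≤ s) :
    Tendsto (harmonicPow s) atTop (nhds (zeta s)) := by
  have hsum : Summable fun m : ℕ => ((m : ℝ) + 1)⁻¹ ^ s := by
    have h := (summable_nat_add_iff 1).2 (Real.summable_nat_pow_inv.2 (show 1 < s by lia))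
    simpa using h
  have h : Tendsto (harmonicPow s) atTop _ := hsum.hasSum.tendsto_sum_nat
  have hz : zeta s = ∑' m : ℕ, ((m : ℝ) + 1)⁻¹ ^ s := by
    rw [zeta, if_neg (by lia)]
    refine (h.congr fun N => ?_).limUnder_eq
    exact Finset.sum_congr rfl fun m _ => by rw [inv_pow, one_div]
  rwa [hz]

theorem harmonicPow_succ (s N : ℕ) :
    harmonicPow s (N + 1) = harmonicPow s N + ((N : ℝ) + 1)⁻¹ ^ s :=
  Finset.sum_range_succ _ _

theorem altHarmonicPow_succ (r N : ℕ) :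
    altHarmonicPow r (N + 1) =
      altHarmonicPow r N + (-1 : ℝ) ^ (N + 1) * ((N : ℝ) + 1)⁻¹ ^ r :=
  Finset.sum_range_succ _ _

theorem altHarmonicPow_sub_mem (r d p : ℕ) :
    0 ≤ (-1 : ℝ) ^ (p + 1) * (altHarmonicPow r (p + d) - altHarmonicPow r p) ∧
      (-1 : ℝ) ^ (p + 1) * (altHarmonicPow r (p + d) - altHarmonicPow r p)
        ≤ ((p : ℝ) + 1)⁻¹ ^ r := by
  induction d generalizing p with
  | zero => simpa using by positivity
  | succ d ih =>
    obtain ⟨h0, h1⟩ := ih (p + 1)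
    have hsign : (-1 : ℝ) ^ (p + 1) * (-1 : ℝ) ^ (p + 1) = 1 := by
      rw [← mul_pow]; simp
    have hanti := antitone_inv_succ_pow r (Nat.le_succ p)
    have key : (-1 : ℝ) ^ (p + 1) * (altHarmonicPow r (p + (d + 1)) - altHarmonicPow r p) =
        ((p : ℝ) + 1)⁻¹ ^ r - (-1 : ℝ) ^ (p + 1 + 1) *
          (altHarmonicPow r (p + 1 + d) - altHarmonicPow r (p + 1)) := by
      rw [show p + (d + 1) = p + 1 + d by ring, altHarmonicPow_succ r p]
      linear_combination ((p : ℝ) + 1)⁻¹ ^ r * hsign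
    dsimp only [Nat.succ_eq_add_one] at hanti
    rw [key]
    constructor <;> linarith

theorem abs_altHarmonicPow_sub_le {r : ℕ} (hr : 1 ≤ r) {p q : ℕ} (hpq : p ≤ q) :
    |altHarmonicPow r q - altHarmonicPow r p| ≤ ((p : ℝ) + 1)⁻¹ := by
  obtain ⟨d, rfl⟩ := Nat.exists_eq_add_of_le hpq
  obtain ⟨h0, h1⟩ := altHarmonicPow_sub_mem r d p
  have h : |altHarmonicPow r (p + d) - altHarmonicPow r p| =
      |(-1 : ℝ) ^ (p + 1) * (altHarmonicPow r (p + d) - altHarmonicPow r p)| := by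
    simp [abs_mul]
  rw [h, abs_of_nonneg h0]
  exact h1.trans (inv_succ_pow_le hr p)

theorem abs_harmonicPow_sub_le {s : ℕ} (hs : 2 ≤ s) {p q : ℕ} (hpq : p ≤ q) :
    |harmonicPow s q - harmonicPow s p| ≤ 2 * ((p : ℝ) + 1)⁻¹ := by
  have h : harmonicPow s q - harmonicPow s p = ∑ m ∈ Finset.Ico p q, ((m : ℝ) + 1)⁻¹ ^ s :=
    (Finset.sum_Ico_eq_sub _ hpq).symm
  have hshift : ∑ m ∈ Finset.Ico p q, ((m : ℝ) + 1)⁻¹ ^ 2 =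
      ∑ m ∈ Finset.Ioo p (q + 1), ((m : ℝ) ^ 2)⁻¹ := by
    rw [show Finset.Ioo p (q + 1) = Finset.Ico (p + 1) (q + 1) by ext; simp,
      ← Finset.sum_Ico_add']
    simp
  rw [h, abs_of_nonneg (Finset.sum_nonneg fun _ _ => by positivity), ← div_eq_mul_inv]
  refine le_trans (Finset.sum_le_sum fun m _ => ?_) (hshift.trans_le (sum_Ioo_inv_sq_le p (q + 1)))
  exact pow_le_pow_of_le_one (by positivity) (inv_le_one_of_one_le₀ (by simp)) hs

/-- The convolution `∑ 1 / (m (M + 1 - m))` controlling all truncation errors. -/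
noncomputable def invConvolution (M : ℕ) : ℝ :=
  ∑ m ∈ Finset.range M, ((m : ℝ) + 1)⁻¹ * (((M - (m + 1) : ℕ) : ℝ) + 1)⁻¹

theorem tendsto_invConvolution : Tendsto invConvolution atTop (nhds 0) := by
  have hc := ((tendsto_inv_succ_pow le_rfl).cesaro).const_mul 2
  simp only [pow_one, mul_zero] at hc
  refine squeeze_zero (fun M => Finset.sum_nonneg fun _ _ => by positivity) (fun M => ?_) hc
  rcases Nat.eq_zero_or_pos M with rfl | hM
  · simp [invConvolution]
  have hrefl : ∑ m ∈ Finset.range M, (((M - (m + 1) : ℕ) : ℝ) + 1)⁻¹ =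
      ∑ m ∈ Finset.range M, ((m : ℝ) + 1)⁻¹ := by
    rw [← Finset.sum_range_reflect]
    refine Finset.sum_congr rfl fun m hm => ?_
    rw [show M - (M - 1 - m + 1) = m by have := Finset.mem_range.1 hm; lia]
  calc invConvolution M
      ≤ ∑ m ∈ Finset.range M, (M : ℝ)⁻¹ *
          (((m : ℝ) + 1)⁻¹ + (((M - (m + 1) : ℕ) : ℝ) + 1)⁻¹) := by
        refine Finset.sum_le_sum fun m hm => ?_
        obtain ⟨d, rfl⟩ := Nat.exists_eq_add_of_le (Nat.succ_le_of_lt (Finset.mem_range.1 hm))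
        rw [show m.succ + d - (m + 1) = d by lia]
        have hsum : ((m : ℝ) + 1)⁻¹ + ((d : ℝ) + 1)⁻¹ =
            ((m : ℝ) + d + 2) * (((m : ℝ) + 1)⁻¹ * ((d : ℝ) + 1)⁻¹) := by
          field_simp; ring
        rw [hsum, ← mul_assoc]
        refine le_mul_of_one_le_left (by positivity) ?_
        push_cast
        rw [inv_mul_eq_div, one_le_div (by positivity)]
        linarith
    _ = 2 * ((M : ℝ)⁻¹ * ∑ m ∈ Finset.range M, ((m : ℝ) + 1)⁻¹) := by
        rw [← Finset.mul_sum, Finset.sum_add_distrib, hrefl]; ring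

theorem tendsto_zero_of_abs_le_mul_invConvolution {f : ℕ → ℝ} (c : ℝ)
    (hf : ∀ M, |f M| ≤ c * invConvolution M) : Tendsto f atTop (nhds 0) := by
  refine squeeze_zero_norm hf ?_
  simpa using tendsto_invConvolution.const_mul c

theorem abs_sum_le_mul_invConvolution {M : ℕ} {c : ℝ} {f : ℕ → ℝ}
    (hf : ∀ m < M, |f m| ≤ c * (((m : ℝ) + 1)⁻¹ * (((M - (m + 1) : ℕ) : ℝ) + 1)⁻¹)) :
    |∑ m ∈ Finset.range M, f m| ≤ c * invConvolution M := by
  rw [invConvolution, Finset.mul_sum]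
  exact (Finset.abs_sum_le_sum_abs _ _).trans
    (Finset.sum_le_sum fun m hm => hf m (Finset.mem_range.1 hm))

/-- One half of the partial fraction expansion of `1 / (x ^ (a + 1) * y ^ (b + 1))`, in the
variables `u = 1 / (x + y)` and `v = 1 / x`. -/
noncomputable def partialFractionPart (a b : ℕ) (u v : ℝ) : ℝ :=
  ∑ t ∈ Finset.range (a + b + 1), (t.choose b : ℝ) * u ^ (t + 1) * v ^ (a + b + 1 - t)

theorem partialFractionPart_succ_succ (a b : ℕ) (u v : ℝ) :
    partialFractionPart (a + 1) (b + 1) u v =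
      u * (partialFractionPart (a + 1) b u v + partialFractionPart a (b + 1) u v) := by
  unfold partialFractionPart
  rw [show a + 1 + (b + 1) + 1 = (a + b + 2) + 1 by ring, Finset.sum_range_succ',
    show a + 1 + b + 1 = a + b + 2 by ring, show a + (b + 1) + 1 = a + b + 2 by ring,
    ← Finset.sum_add_distrib, Finset.mul_sum]
  simp only [Nat.choose_zero_succ, Nat.cast_zero, zero_mul, add_zero]
  refine Finset.sum_congr rfl fun t _ => ?_
  rw [Nat.choose_succ_succ, show a + b + 2 + 1 - (t + 1) = a + b + 2 - t by lia]
  push_cast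
  ring

theorem partialFractionPart_succ_zero (a : ℕ) (u v : ℝ) :
    partialFractionPart (a + 1) 0 u v = u * (v ^ (a + 2) + partialFractionPart a 0 u v) := by
  unfold partialFractionPart
  rw [Finset.sum_range_succ', mul_add, Finset.mul_sum, add_comm]
  congr 1
  · simp
  · refine Finset.sum_congr rfl fun t _ => ?_
    rw [show a + 1 + 0 + 1 - (t + 1) = a + 0 + 1 - t by lia]
    simp only [Nat.choose_zero_right]
    ring

theorem partialFractionPart_zero_succ (b : ℕ) (u v : ℝ) :
    partialFractionPart 0 (b + 1) u v = u * partialFractionPart 0 b u v := by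
  unfold partialFractionPart
  rw [Finset.sum_range_succ', Finset.mul_sum, Nat.choose_zero_succ]
  simp only [Nat.cast_zero, zero_mul, add_zero]
  refine Finset.sum_congr rfl fun t ht => ?_
  have ht' : t ≤ b := by have := Finset.mem_range.1 ht; lia
  rw [Nat.choose_succ_succ, Nat.choose_eq_zero_of_lt (show t < b + 1 by lia),
    show 0 + (b + 1) + 1 - (t + 1) = 0 + b + 1 - t by lia]
  push_cast
  ring

theorem partialFraction {u v w : ℝ} (h : v * w = u * (v + w)) (a b : ℕ) :
    v ^ (a + 1) * w ^ (b + 1) = partialFractionPart a b u v + partialFractionPart b a u w := by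
  induction a generalizing b with
  | zero =>
    induction b with
    | zero => simp [partialFractionPart]; linear_combination h
    | succ b ih =>
      rw [partialFractionPart_zero_succ, partialFractionPart_succ_zero]
      linear_combination w ^ (b + 1) * h + u * ih
  | succ a iha =>
    induction b with
    | zero =>
      rw [partialFractionPart_zero_succ, partialFractionPart_succ_zero]
      linear_combination v ^ (a + 1) * h + u * iha 0
    | succ b ihb =>
      rw [partialFractionPart_succ_succ, partialFractionPart_succ_succ b a]
      linear_combination v ^ (a + 1) * w ^ (b + 1) * h + u * ihb + u * iha (b + 1)

theorem partialFractionPart_diag (a b : ℕ) (u : ℝ) :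
    partialFractionPart a b u u = ((a + b + 1).choose (b + 1) : ℝ) * u ^ (a + b + 2) := by
  have hockey : ∑ t ∈ Finset.range (a + b + 1), t.choose b = (a + b + 1).choose (b + 1) := by
    induction a with
    | zero =>
      rw [zero_add, Finset.sum_range_succ, Finset.sum_eq_zero fun t ht =>
        Nat.choose_eq_zero_of_lt (Finset.mem_range.1 ht)]
      simp
    | succ a ih =>
      rw [show a + 1 + b + 1 = a + b + 1 + 1 by ring, Finset.sum_range_succ, ih,
        Nat.choose_succ_succ (a + b + 1) b, add_comm]
  rw [partialFractionPart, ← hockey, Nat.cast_sum, Finset.sum_mul]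
  refine Finset.sum_congr rfl fun t ht => ?_
  rw [mul_assoc, ← pow_add,
    show t + 1 + (a + b + 1 - t) = a + b + 2 by have := Finset.mem_range.1 ht; lia]

theorem partialFractionPart_zero_right (a b : ℕ) (u : ℝ) :
    partialFractionPart a b u 0 = 0 := by
  refine Finset.sum_eq_zero fun t ht => ?_
  rw [zero_pow (by have := Finset.mem_range.1 ht; lia), mul_zero]

theorem sum_Icc_neg_natCast (g : ℤ → ℝ) (P Q : ℕ) :
    ∑ j ∈ Finset.Icc (-(P : ℤ)) Q, g j = g 0 + ∑ m ∈ Finset.range Q, g ((m : ℤ) + 1)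
      + ∑ m ∈ Finset.range P, g (-((m : ℤ) + 1)) := by
  induction P with
  | zero =>
    induction Q with
    | zero => simp
    | succ Q ih =>
      have h : Finset.Icc (-((0 : ℕ) : ℤ)) ((Q + 1 : ℕ) : ℤ) =
          insert ((Q : ℤ) + 1) (Finset.Icc (-((0 : ℕ) : ℤ)) (Q : ℤ)) := by
        ext j; simp only [Finset.mem_insert, Finset.mem_Icc]; lia
      rw [h, Finset.sum_insert (by simp), ih, Finset.sum_range_succ]
      ring
  | succ P ih =>
    have h : Finset.Icc (-((P + 1 : ℕ) : ℤ)) (Q : ℤ) =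
        insert (-((P : ℤ) + 1)) (Finset.Icc (-(P : ℤ)) (Q : ℤ)) := by
      ext j; simp only [Finset.mem_insert, Finset.mem_Icc]; lia
    rw [h, Finset.sum_insert (by simp), ih, Finset.sum_range_succ]
    ring

theorem sum_Icc_alternating {i : ℕ} (hi : 1 ≤ i) (P Q : ℕ) :
    ∑ j ∈ Finset.Icc (-(P : ℤ)) Q, (-1 : ℝ) ^ j * (j : ℝ)⁻¹ ^ i =
      altHarmonicPow i Q + (-1 : ℝ) ^ i * altHarmonicPow i P := by
  rw [sum_Icc_neg_natCast, altHarmonicPow, altHarmonicPow, Finset.mul_sum]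
  have h0 : (-1 : ℝ) ^ (0 : ℤ) * ((0 : ℤ) : ℝ)⁻¹ ^ i = 0 := by
    simp [zero_pow (show i ≠ 0 by lia)]
  rw [h0, zero_add]
  congr 1
  · refine Finset.sum_congr rfl fun m _ => ?_
    rw [← Nat.cast_add_one, zpow_natCast]
    push_cast
    rfl
  · refine Finset.sum_congr rfl fun m _ => ?_
    rw [← Nat.cast_add_one, zpow_neg, zpow_natCast, ← inv_pow, inv_neg_one]
    push_cast
    rw [inv_neg, neg_pow (((m : ℝ) + 1)⁻¹)]
    ring

theorem sum_Icc_alternating_sub {i n M : ℕ} (hi : 1 ≤ i) (hn : n ≤ M) :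
    ∑ j ∈ Finset.Icc (-(M : ℤ)) M, (-1 : ℝ) ^ j * ((n : ℝ) - j)⁻¹ ^ i =
      (-1 : ℝ) ^ n * (altHarmonicPow i (M + n) + (-1 : ℝ) ^ i * altHarmonicPow i (M - n)) := by
  rw [← sum_Icc_alternating hi, Finset.mul_sum]
  refine Finset.sum_nbij' (fun j => (n : ℤ) - j) (fun j => (n : ℤ) - j) ?_ ?_ ?_ ?_ ?_
  · intro j hj; simp only [Finset.mem_Icc] at hj ⊢; lia
  · intro j hj; simp only [Finset.mem_Icc] at hj ⊢; lia
  · intro j _; ring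
  · intro j _; ring
  · intro j _
    have hsign : (-1 : ℝ) ^ n * (-1 : ℝ) ^ ((n : ℤ) - j) = (-1 : ℝ) ^ j := by
      rw [← zpow_natCast, ← zpow_add₀ (by norm_num), show (n : ℤ) + (n - j) = 2 * n - j by ring,
        zpow_sub₀ (by norm_num), zpow_mul]
      simp [← inv_zpow]
    rw [← mul_assoc, hsign]
    push_cast
    rfl

/-- The sum over `0 < |j| ≤ M`, `j ≠ n`, of `(-1) ^ j / (j ^ (a + 1) * (n - j) ^ (b + 1))`. -/
noncomputable def alternatingRow (a b M n : ℕ) : ℝ :=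
  ∑ j ∈ Finset.Icc (-(M : ℤ)) M,
    (-1 : ℝ) ^ j * ((j : ℝ)⁻¹ ^ (a + 1) * ((n : ℝ) - j)⁻¹ ^ (b + 1))

theorem alternatingRow_term (a b : ℕ) {n : ℕ} (hn : n ≠ 0) (j : ℤ) :
    (-1 : ℝ) ^ j * ((j : ℝ)⁻¹ ^ (a + 1) * ((n : ℝ) - j)⁻¹ ^ (b + 1)) =
      (-1 : ℝ) ^ j * partialFractionPart a b (n : ℝ)⁻¹ (j : ℝ)⁻¹
      + (-1 : ℝ) ^ j * partialFractionPart b a (n : ℝ)⁻¹ ((n : ℝ) - j)⁻¹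
      - (if j = 0 then ((a + b + 1).choose (a + 1) : ℝ) * (n : ℝ)⁻¹ ^ (a + b + 2) else 0)
      - (if j = n then (-1 : ℝ) ^ n * (((a + b + 1).choose (b + 1) : ℝ) *
          (n : ℝ)⁻¹ ^ (a + b + 2)) else 0) := by
  have hn' : (n : ℝ) ≠ 0 := by exact_mod_cast hn
  by_cases h0 : j = 0
  · subst h0
    rw [if_pos rfl, if_neg (by lia), Int.cast_zero, inv_zero, sub_zero,
      partialFractionPart_zero_right, partialFractionPart_diag, add_comm b a]
    simp
  by_cases h1 : j = n
  · subst h1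
    rw [if_neg h0, if_pos rfl, Int.cast_natCast, sub_self, inv_zero,
      partialFractionPart_zero_right, partialFractionPart_diag, zpow_natCast]
    simp
  · have hj : (j : ℝ) ≠ 0 := by exact_mod_cast h0
    have hnj : (n : ℝ) - j ≠ 0 := by
      rw [sub_ne_zero]; exact_mod_cast Ne.symm h1
    rw [if_neg h0, if_neg h1, partialFraction (u := (n : ℝ)⁻¹) (by field_simp; ring)]
    ring

theorem alternatingRow_eq (a b : ℕ) {n M : ℕ} (hn : n ≠ 0) (hM : n ≤ M) :
    alternatingRow a b M n =
      ∑ t ∈ Finset.range (a + b + 1), (t.choose b : ℝ) * (n : ℝ)⁻¹ ^ (t + 1) *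
        (altHarmonicPow (a + b + 1 - t) M
          + (-1 : ℝ) ^ (a + b + 1 - t) * altHarmonicPow (a + b + 1 - t) M)
      + ∑ t ∈ Finset.range (a + b + 1), (t.choose a : ℝ) * (n : ℝ)⁻¹ ^ (t + 1) *
        ((-1 : ℝ) ^ n * (altHarmonicPow (a + b + 1 - t) (M + n)
          + (-1 : ℝ) ^ (a + b + 1 - t) * altHarmonicPow (a + b + 1 - t) (M - n)))
      - ((a + b + 1).choose (a + 1) : ℝ) * (n : ℝ)⁻¹ ^ (a + b + 2)
      - (-1 : ℝ) ^ n * (((a + b + 1).choose (b + 1) : ℝ) * (n : ℝ)⁻¹ ^ (a + b + 2)) := by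
  have expand (c d : ℕ) (x : ℤ → ℝ) :
      ∑ j ∈ Finset.Icc (-(M : ℤ)) M, (-1 : ℝ) ^ j * partialFractionPart c d (n : ℝ)⁻¹ (x j) =
        ∑ t ∈ Finset.range (c + d + 1), (t.choose d : ℝ) * (n : ℝ)⁻¹ ^ (t + 1) *
          ∑ j ∈ Finset.Icc (-(M : ℤ)) M, (-1 : ℝ) ^ j * x j ^ (c + d + 1 - t) := by
    simp only [partialFractionPart, Finset.mul_sum]
    rw [Finset.sum_comm]
    exact Finset.sum_congr rfl fun _ _ => Finset.sum_congr rfl fun _ _ => by ring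
  rw [alternatingRow, Finset.sum_congr rfl fun j _ => alternatingRow_term a b hn j,
    Finset.sum_sub_distrib, Finset.sum_sub_distrib, Finset.sum_add_distrib, expand, expand,
    Finset.sum_ite_eq', Finset.sum_ite_eq', if_pos (by simp), if_pos (by simp; lia), add_comm b a]
  congr 3
  · refine Finset.sum_congr rfl fun t ht => ?_
    rw [sum_Icc_alternating (by have := Finset.mem_range.1 ht; lia)]
  · refine Finset.sum_congr rfl fun t ht => ?_
    rw [sum_Icc_alternating_sub (by have := Finset.mem_range.1 ht; lia) hM]

theorem sum_range_inv_sub_pow {s m M : ℕ} (hs : 1 ≤ s) (hm : m < M) :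
    ∑ n ∈ Finset.range M, ((n : ℝ) - m)⁻¹ ^ s =
      harmonicPow s (M - (m + 1)) + (-1 : ℝ) ^ s * harmonicPow s m := by
  obtain ⟨d, rfl⟩ := Nat.exists_eq_add_of_le (Nat.succ_le_of_lt hm)
  rw [Finset.sum_range_add, Nat.succ_eq_add_one, Nat.add_sub_cancel_left,
    Finset.sum_range_succ, sub_self, inv_zero, zero_pow (by lia), add_zero, add_comm,
    ← Finset.sum_range_reflect (fun n : ℕ => ((n : ℝ) - m)⁻¹ ^ s), harmonicPow, harmonicPow,
    Finset.mul_sum]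
  congr 1
  · refine Finset.sum_congr rfl fun x _ => ?_
    push_cast
    ring_nf
  · refine Finset.sum_congr rfl fun x hx => ?_
    obtain ⟨e, rfl⟩ := Nat.exists_eq_add_of_le (Nat.succ_le_of_lt (Finset.mem_range.1 hx))
    rw [show x.succ + e - 1 - x = e by lia, ← mul_pow, neg_one_mul, ← inv_neg]
    push_cast
    ring_nf

theorem sum_range_inv_add_pow (s m M : ℕ) :
    ∑ n ∈ Finset.range M, (((n : ℝ) + 1) + (m + 1))⁻¹ ^ s =
      harmonicPow s (m + 1 + M) - harmonicPow s (m + 1) := by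
  rw [harmonicPow, Finset.sum_range_add, harmonicPow, add_sub_cancel_left]
  refine Finset.sum_congr rfl fun x _ => ?_
  push_cast
  ring_nf

theorem sum_alternatingRow (a b M : ℕ) :
    ∑ n ∈ Finset.range M, alternatingRow a b M (n + 1) =
      ∑ m ∈ Finset.range M, (-1 : ℝ) ^ (m + 1) * ((m : ℝ) + 1)⁻¹ ^ (a + 1) *
        ((harmonicPow (b + 1) (M - (m + 1)) + (-1 : ℝ) ^ (b + 1) * harmonicPow (b + 1) m)
          + (-1 : ℝ) ^ (a + 1) *
            (harmonicPow (b + 1) (m + 1 + M) - harmonicPow (b + 1) (m + 1))) := by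
  have hrow (n : ℕ) : alternatingRow a b M (n + 1) =
      ∑ m ∈ Finset.range M, (-1 : ℝ) ^ (m + 1) * ((m : ℝ) + 1)⁻¹ ^ (a + 1) *
        (((n : ℝ) - m)⁻¹ ^ (b + 1)
          + (-1 : ℝ) ^ (a + 1) * (((n : ℝ) + 1) + (m + 1))⁻¹ ^ (b + 1)) := by
    rw [alternatingRow, sum_Icc_neg_natCast]
    simp only [Int.cast_zero, inv_zero, zero_pow (Nat.succ_ne_zero a), zero_mul, mul_zero,
      zero_add]
    rw [← Finset.sum_add_distrib]
    refine Finset.sum_congr rfl fun m _ => ?_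
    rw [← Nat.cast_add_one m, zpow_neg, zpow_natCast, ← inv_pow, inv_neg_one]
    push_cast
    rw [inv_neg, neg_pow (((m : ℝ) + 1)⁻¹), sub_neg_eq_add, add_sub_add_right_eq_sub]
    ring
  simp only [hrow]
  rw [Finset.sum_comm]
  refine Finset.sum_congr rfl fun m hm => ?_
  rw [← Finset.mul_sum, Finset.sum_add_distrib, ← Finset.mul_sum,
    sum_range_inv_sub_pow (by lia) (Finset.mem_range.1 hm), sum_range_inv_add_pow]

/-- The partial sums of `ζ(r̄, s)`. -/
noncomputable def altDoubleSum (r s M : ℕ) : ℝ :=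
  ∑ n ∈ Finset.range M, ((n : ℝ) + 1)⁻¹ ^ s * altHarmonicPow r n

theorem altDoubleSum_eq (r s M : ℕ) :
    altDoubleSum r s M = ∑ m ∈ Finset.range M, (-1 : ℝ) ^ (m + 1) * ((m : ℝ) + 1)⁻¹ ^ r *
      (harmonicPow s M - harmonicPow s (m + 1)) := by
  induction M with
  | zero => simp [altDoubleSum]
  | succ M ih =>
    rw [altDoubleSum, Finset.sum_range_succ, ← altDoubleSum, ih, Finset.sum_range_succ, sub_self,
      mul_zero, add_zero, altHarmonicPow, Finset.mul_sum, ← Finset.sum_add_distrib]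
    refine Finset.sum_congr rfl fun m _ => ?_
    rw [harmonicPow_succ s M]
    ring

theorem dzetaA1_eq_of_tendsto {r s : ℕ} {l : ℝ}
    (h : Tendsto (altDoubleSum r s) atTop (nhds l)) : dzetaA1 r s = l := by
  refine ((h.comp (tendsto_add_atTop_nat 1)).congr fun N => ?_).limUnder_eq
  rw [Function.comp_apply, altDoubleSum, Finset.sum_range_succ']
  simp only [altHarmonicPow, Finset.range_zero, Finset.sum_empty, mul_zero, add_zero]
  refine Finset.sum_congr rfl fun m _ => ?_
  push_cast
  rw [add_assoc, one_add_one_eq_two, inv_pow, one_div]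
  congr 1
  exact Finset.sum_congr rfl fun j _ => by rw [inv_pow, div_eq_mul_inv]

theorem sum_alternatingRow_sub_tendsto {a b : ℕ} (hb : 1 ≤ b)
    (hsign : (-1 : ℝ) ^ (b + 1) = -(-1 : ℝ) ^ (a + 1)) :
    Tendsto (fun M => ∑ n ∈ Finset.range M, alternatingRow a b M (n + 1)
      - (2 * (-1 : ℝ) ^ (a + 1) * altDoubleSum (a + 1) (b + 1) M
        + (1 - (-1 : ℝ) ^ (a + 1)) * (altHarmonicPow (a + 1) M * harmonicPow (b + 1) M)
        + (-1 : ℝ) ^ (a + 1) * altHarmonicPow (a + b + 2) M)) atTop (nhds 0) := by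
  refine tendsto_zero_of_abs_le_mul_invConvolution 4 fun M => ?_
  have key : ∑ n ∈ Finset.range M, alternatingRow a b M (n + 1)
      - (2 * (-1 : ℝ) ^ (a + 1) * altDoubleSum (a + 1) (b + 1) M
        + (1 - (-1 : ℝ) ^ (a + 1)) * (altHarmonicPow (a + 1) M * harmonicPow (b + 1) M)
        + (-1 : ℝ) ^ (a + 1) * altHarmonicPow (a + b + 2) M) =
      ∑ m ∈ Finset.range M, (-1 : ℝ) ^ (m + 1) * ((m : ℝ) + 1)⁻¹ ^ (a + 1) *
        ((-1 : ℝ) ^ (a + 1) * (harmonicPow (b + 1) (m + 1 + M) - harmonicPow (b + 1) M)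
          - (harmonicPow (b + 1) M - harmonicPow (b + 1) (M - (m + 1)))) := by
    rw [sum_alternatingRow, altDoubleSum_eq, altHarmonicPow, altHarmonicPow, Finset.sum_mul,
      Finset.mul_sum, Finset.mul_sum, Finset.mul_sum, ← Finset.sum_add_distrib,
      ← Finset.sum_add_distrib, ← Finset.sum_sub_distrib]
    refine Finset.sum_congr rfl fun m _ => ?_
    rw [hsign, harmonicPow_succ (b + 1) m]
    ring
  rw [key]
  refine abs_sum_le_mul_invConvolution fun m hm => ?_
  have h1 := abs_harmonicPow_sub_le (s := b + 1) (by lia) (Nat.le_add_left M (m + 1))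
  have h2 := abs_harmonicPow_sub_le (s := b + 1) (by lia) (Nat.sub_le M (m + 1))
  have h3 : ((M : ℝ) + 1)⁻¹ ≤ (((M - (m + 1) : ℕ) : ℝ) + 1)⁻¹ := by
    gcongr; exact Nat.sub_le M (m + 1)
  have h4 := inv_succ_pow_le (i := a + 1) (by lia) m
  have h5 := abs_sub
    ((-1 : ℝ) ^ (a + 1) * (harmonicPow (b + 1) (m + 1 + M) - harmonicPow (b + 1) M))
    (harmonicPow (b + 1) M - harmonicPow (b + 1) (M - (m + 1)))
  rw [abs_mul, abs_pow, abs_neg, abs_one, one_pow, one_mul] at h5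
  rw [abs_mul, abs_mul, abs_pow, abs_neg, abs_one, one_pow, one_mul,
    abs_of_nonneg (a := ((m : ℝ) + 1)⁻¹ ^ (a + 1)) (by positivity), mul_left_comm]
  exact mul_le_mul h4 (by linarith) (abs_nonneg _) (by positivity)

theorem sum_alternatingRow_sub_main_tendsto (a b : ℕ) :
    Tendsto (fun M => ∑ n ∈ Finset.range M, alternatingRow a b M (n + 1)
      - (∑ t ∈ Finset.range (a + b + 1),
          (t.choose b * harmonicPow (t + 1) M + t.choose a * altHarmonicPow (t + 1) M) *
            ((1 + (-1 : ℝ) ^ (a + b + 1 - t)) * altHarmonicPow (a + b + 1 - t) M)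
        - (a + b + 1).choose (a + 1) * harmonicPow (a + b + 2) M
        - (a + b + 1).choose (b + 1) * altHarmonicPow (a + b + 2) M)) atTop (nhds 0) := by
  refine tendsto_zero_of_abs_le_mul_invConvolution
    (∑ t ∈ Finset.range (a + b + 1), (t.choose a : ℝ) * 2) fun M => ?_
  have key : ∑ n ∈ Finset.range M, alternatingRow a b M (n + 1)
      - (∑ t ∈ Finset.range (a + b + 1),
          (t.choose b * harmonicPow (t + 1) M + t.choose a * altHarmonicPow (t + 1) M) *
            ((1 + (-1 : ℝ) ^ (a + b + 1 - t)) * altHarmonicPow (a + b + 1 - t) M)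
        - (a + b + 1).choose (a + 1) * harmonicPow (a + b + 2) M
        - (a + b + 1).choose (b + 1) * altHarmonicPow (a + b + 2) M) =
      ∑ n ∈ Finset.range M, ∑ t ∈ Finset.range (a + b + 1),
        (t.choose a : ℝ) * ((n : ℝ) + 1)⁻¹ ^ (t + 1) * ((-1 : ℝ) ^ (n + 1) *
          ((altHarmonicPow (a + b + 1 - t) (M + (n + 1)) - altHarmonicPow (a + b + 1 - t) M)
            - (-1 : ℝ) ^ (a + b + 1 - t) *
              (altHarmonicPow (a + b + 1 - t) M
                - altHarmonicPow (a + b + 1 - t) (M - (n + 1))))) := by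
    have hmain : ∑ t ∈ Finset.range (a + b + 1),
          (t.choose b * harmonicPow (t + 1) M + t.choose a * altHarmonicPow (t + 1) M) *
            ((1 + (-1 : ℝ) ^ (a + b + 1 - t)) * altHarmonicPow (a + b + 1 - t) M) =
        ∑ n ∈ Finset.range M, ∑ t ∈ Finset.range (a + b + 1),
          (t.choose b * ((n : ℝ) + 1)⁻¹ ^ (t + 1)
              + t.choose a * ((-1 : ℝ) ^ (n + 1) * ((n : ℝ) + 1)⁻¹ ^ (t + 1))) *
            ((1 + (-1 : ℝ) ^ (a + b + 1 - t)) * altHarmonicPow (a + b + 1 - t) M) := by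
      rw [Finset.sum_comm]
      refine Finset.sum_congr rfl fun t _ => ?_
      rw [← Finset.sum_mul, Finset.sum_add_distrib, ← Finset.mul_sum, ← Finset.mul_sum]
      rfl
    rw [hmain, harmonicPow, altHarmonicPow, Finset.mul_sum, Finset.mul_sum,
      ← Finset.sum_sub_distrib, ← Finset.sum_sub_distrib, ← Finset.sum_sub_distrib]
    refine Finset.sum_congr rfl fun n hn => ?_
    rw [alternatingRow_eq a b n.succ_ne_zero (Nat.succ_le_of_lt (Finset.mem_range.1 hn)),
      ← sub_eq_zero]
    push_cast [Nat.succ_eq_add_one]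
    have regroup (x y z w u v : ℝ) :
        x + y - u - v - (z - u - v) - w = x + y - z - w := by ring
    rw [mul_left_comm ((-1 : ℝ) ^ (n + 1)), regroup, ← Finset.sum_add_distrib,
      ← Finset.sum_sub_distrib, ← Finset.sum_sub_distrib]
    exact Finset.sum_eq_zero fun t _ => by ring
  rw [key]
  refine abs_sum_le_mul_invConvolution fun n hn => (Finset.abs_sum_le_sum_abs _ _).trans ?_
  rw [Finset.sum_mul]
  refine Finset.sum_le_sum fun t ht => ?_
  have hi : 1 ≤ a + b + 1 - t := by have := Finset.mem_range.1 ht; lia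
  have h1 := abs_altHarmonicPow_sub_le hi (Nat.le_add_right M (n + 1))
  have h2 := abs_altHarmonicPow_sub_le hi (Nat.sub_le M (n + 1))
  have h3 : ((M : ℝ) + 1)⁻¹ ≤ (((M - (n + 1) : ℕ) : ℝ) + 1)⁻¹ := by
    gcongr; exact Nat.sub_le M (n + 1)
  have h4 := inv_succ_pow_le (i := t + 1) (by lia) n
  have h5 := abs_sub
    (altHarmonicPow (a + b + 1 - t) (M + (n + 1)) - altHarmonicPow (a + b + 1 - t) M)
    ((-1 : ℝ) ^ (a + b + 1 - t) * (altHarmonicPow (a + b + 1 - t) M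
      - altHarmonicPow (a + b + 1 - t) (M - (n + 1))))
  rw [abs_mul, abs_pow, abs_neg, abs_one, one_pow, one_mul] at h5
  rw [abs_mul, abs_mul, abs_mul, abs_pow (-1 : ℝ) (n + 1), abs_neg, abs_one, one_pow, one_mul,
    Nat.abs_cast, abs_of_nonneg (a := ((n : ℝ) + 1)⁻¹ ^ (t + 1)) (by positivity), mul_assoc,
    mul_assoc, mul_left_comm (2 : ℝ)]
  gcongr
  linarith

theorem sum_range_one_add_neg_one_pow_mul (F : ℕ → ℝ) (q : ℕ) :
    ∑ t ∈ Finset.range (2 * q), (1 + (-1 : ℝ) ^ (2 * q - t)) * F t =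
      2 * ∑ l ∈ Finset.range q, F (2 * q - 2 * (l + 1)) := by
  induction q generalizing F with
  | zero => simp
  | succ q ih =>
    have hodd : (-1 : ℝ) ^ (2 * (q + 1) - 1) = -1 := Odd.neg_one_pow ⟨q, by lia⟩
    have hshift := ih fun t => F (t + 2)
    rw [show 2 * (q + 1) = 2 * q + 1 + 1 by ring] at hodd ⊢
    rw [Finset.sum_range_succ', Finset.sum_range_succ', Finset.sum_range_succ (n := q)]
    simp only [Nat.add_sub_add_right, zero_add, hodd, hshift]
    have hF : ∑ l ∈ Finset.range q, F (2 * q + 1 + 1 - 2 * (l + 1)) =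
        ∑ l ∈ Finset.range q, F (2 * q - 2 * (l + 1) + 2) :=
      Finset.sum_congr rfl fun l hl => by
        rw [show 2 * q + 1 + 1 - 2 * (l + 1) = 2 * q - 2 * (l + 1) + 2 by
          have := Finset.mem_range.1 hl; lia]
    rw [hF]
    rw [show 2 * q + 1 + 1 - 2 * (q + 1) = 0 by lia,
      show (-1 : ℝ) ^ (2 * q + 1 + 1 - 0) = 1 from Even.neg_one_pow ⟨q + 1, by lia⟩]
    ring

theorem tendsto_altDoubleSum {a b : ℕ} (hb : 1 ≤ b)
    (hsign : (-1 : ℝ) ^ (b + 1) = -(-1 : ℝ) ^ (a + 1)) :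
    Tendsto (altDoubleSum (a + 1) (b + 1)) atTop (nhds ((-1 : ℝ) ^ (a + 1) / 2 *
      (∑ t ∈ Finset.range (a + b + 1),
          (t.choose b * zeta (t + 1) + t.choose a * zetaA (t + 1)) *
            ((1 + (-1 : ℝ) ^ (a + b + 1 - t)) * zetaA (a + b + 1 - t))
        - (a + b + 1).choose (a + 1) * zeta (a + b + 2)
        - (a + b + 1).choose (b + 1) * zetaA (a + b + 2)
        - (1 - (-1 : ℝ) ^ (a + 1)) * (zetaA (a + 1) * zeta (b + 1))
        - (-1 : ℝ) ^ (a + 1) * zetaA (a + b + 2)))) := by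
  have hsum : Tendsto (fun M => ∑ t ∈ Finset.range (a + b + 1),
      (t.choose b * harmonicPow (t + 1) M + t.choose a * altHarmonicPow (t + 1) M) *
        ((1 + (-1 : ℝ) ^ (a + b + 1 - t)) * altHarmonicPow (a + b + 1 - t) M)) atTop
      (nhds (∑ t ∈ Finset.range (a + b + 1),
        (t.choose b * zeta (t + 1) + t.choose a * zetaA (t + 1)) *
          ((1 + (-1 : ℝ) ^ (a + b + 1 - t)) * zetaA (a + b + 1 - t)))) := by
    refine tendsto_finsetSum _ fun t ht => ?_
    have hi : 1 ≤ a + b + 1 - t := by have := Finset.mem_range.1 ht; lia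
    refine Tendsto.mul (Tendsto.add ?_ ((tendsto_altHarmonicPow (by lia)).const_mul _))
      ((tendsto_altHarmonicPow hi).const_mul _)
    rcases Nat.eq_zero_or_pos t with rfl | ht0
    · simp [Nat.choose_eq_zero_of_lt (show 0 < b from hb)]
    · exact (tendsto_harmonicPow (by lia)).const_mul _
  have hA := tendsto_altHarmonicPow (r := a + b + 2) (by lia)
  have hH := tendsto_harmonicPow (s := a + b + 2) (by lia)
  have hprod := (tendsto_altHarmonicPow (r := a + 1) (by lia)).mul
    (tendsto_harmonicPow (s := b + 1) (by lia))
  have hmain := ((((hsum.sub (hH.const_mul ((a + b + 1).choose (a + 1) : ℝ))).sub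
    (hA.const_mul ((a + b + 1).choose (b + 1) : ℝ))).sub
    (hprod.const_mul (1 - (-1 : ℝ) ^ (a + 1)))).sub
    (hA.const_mul ((-1 : ℝ) ^ (a + 1)))).add
    ((sum_alternatingRow_sub_main_tendsto a b).sub (sum_alternatingRow_sub_tendsto hb hsign))
  rw [sub_zero, add_zero] at hmain
  have hsq : (-1 : ℝ) ^ (a + 1) * (-1 : ℝ) ^ (a + 1) = 1 := by rw [← mul_pow]; simp
  refine (hmain.const_mul ((-1 : ℝ) ^ (a + 1) / 2)).congr fun M => ?_
  linear_combination altDoubleSum (a + 1) (b + 1) M * hsq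

theorem dzetaA1_eval (r s k : ℕ) (hr : 1 ≤ r) (hs : 2 ≤ s) (hk : r + s = k)
    (hk3 : 3 ≤ k) (hodd : Odd k) :
    dzetaA1 r s = -(1/2) * zetaA k + ((1 + (-1 : ℝ)^s)/2) * zetaA r * zeta s
      + (-1 : ℝ)^r * ∑ l ∈ Finset.range ((k-1)/2 + 1),
          (((k-2*l-1).choose (r-1) : ℝ) * zetaA (k-2*l)
            + ((k-2*l-1).choose (s-1) : ℝ) * zeta (k-2*l)) * zetaA (2*l) := by
  obtain ⟨q, hq⟩ := hodd
  obtain ⟨a, rfl⟩ := Nat.exists_eq_add_of_le' hr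
  obtain ⟨b, rfl⟩ := Nat.exists_eq_add_of_le' (show 1 ≤ s by lia)
  have hab : a + b + 1 = 2 * q := by lia
  have hk' : k = a + b + 2 := by lia
  have hsq : (-1 : ℝ) ^ (a + 1) * (-1 : ℝ) ^ (a + 1) = 1 := by rw [← mul_pow]; simp
  have hsign : (-1 : ℝ) ^ (b + 1) = -(-1 : ℝ) ^ (a + 1) := by
    have hodd : (-1 : ℝ) ^ (a + 1 + (b + 1)) = -1 := Odd.neg_one_pow ⟨q, by lia⟩
    rw [pow_add] at hodd
    linear_combination (-1 : ℝ) ^ (a + 1) * hodd - (-1 : ℝ) ^ (b + 1) * hsq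
  rw [dzetaA1_eq_of_tendsto (tendsto_altDoubleSum (by lia) hsign), hsign,
    show (k - 1) / 2 = q by lia, Finset.sum_range_succ' (n := q)]
  have hzero : zetaA (2 * 0) = -1 / 2 := by simp [zetaA]
  have hchoose₁ : (k - 2 * 0 - 1).choose (a + 1 - 1) = (a + b + 1).choose (b + 1) := by
    rw [show k - 2 * 0 - 1 = a + b + 1 by lia]
    exact Nat.choose_symm_of_eq_add (by lia)
  have hchoose₂ : (k - 2 * 0 - 1).choose (b + 1 - 1) = (a + b + 1).choose (a + 1) := by
    rw [show k - 2 * 0 - 1 = a + b + 1 by lia]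
    exact Nat.choose_symm_of_eq_add (by lia)
  have hsum : ∑ t ∈ Finset.range (a + b + 1),
      (t.choose b * zeta (t + 1) + t.choose a * zetaA (t + 1)) *
        ((1 + (-1 : ℝ) ^ (a + b + 1 - t)) * zetaA (a + b + 1 - t)) =
      2 * ∑ l ∈ Finset.range q,
        (((k - 2 * (l + 1) - 1).choose (a + 1 - 1) : ℝ) * zetaA (k - 2 * (l + 1))
          + ((k - 2 * (l + 1) - 1).choose (b + 1 - 1) : ℝ) * zeta (k - 2 * (l + 1))) *
          zetaA (2 * (l + 1)) := by
    have h := sum_range_one_add_neg_one_pow_mul (fun t =>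
      (t.choose b * zeta (t + 1) + t.choose a * zetaA (t + 1)) * zetaA (2 * q - t)) q
    rw [hab]
    refine Eq.trans (Finset.sum_congr rfl fun t _ => by ring) (h.trans ?_)
    congr 1
    refine Finset.sum_congr rfl fun l hl => ?_
    have hl' := Finset.mem_range.1 hl
    rw [show k - 2 * (l + 1) - 1 = 2 * q - 2 * (l + 1) by lia,
      show k - 2 * (l + 1) = 2 * q - 2 * (l + 1) + 1 by lia,
      show 2 * q - (2 * q - 2 * (l + 1)) = 2 * (l + 1) by lia, Nat.add_sub_cancel,
      Nat.add_sub_cancel]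
    ring
  rw [hsum, hzero, hchoose₁, hchoose₂, show k - 2 * 0 = a + b + 2 by lia, hk']
  linear_combination (zetaA (a + 1) * zeta (b + 1) / 2 - zetaA (a + b + 2) / 2) * hsq
end

section
/- Let a, b, c be complex numbers such that none of a/2, 1+a-b, 1+a-c is zero or a negative integer, and Re(2+a-2b-2c) > 0. Then ₄F₃(a, 1+a/2, b, c; a/2, 1+a-b, 1+a-c; -1) = Γ(1+a-b)Γ(1+a-c) / (Γ(1+a)Γ(1+a-b-c)). -/
open Filter Finset

/-- The Pochhammer symbol `(x)_n = x(x+1)⋯(x+n-1)`. -/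
noncomputable def poch (x : ℂ) (n : ℕ) : ℂ := ∏ i ∈ Finset.range n, (x + i)

open scoped Topology

theorem poch_succ (x : ℂ) (n : ℕ) : poch x (n + 1) = poch x n * (x + n) :=
  Finset.prod_range_succ _ _

theorem poch_succ' (x : ℂ) (n : ℕ) : poch x (n + 1) = x * poch (x + 1) n := by
  simp only [poch, Finset.prod_range_succ' _ n, Nat.cast_zero, add_zero]
  rw [mul_comm]
  congr 1
  refine Finset.prod_congr rfl fun i _ => ?_
  push_cast
  ring

theorem poch_ne_zero {x : ℂ} (hx : ∀ n : ℕ, x ≠ -(n : ℂ)) (n : ℕ) : poch x n ≠ 0 :=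
  Finset.prod_ne_zero_iff.2 fun i _ h => hx i (eq_neg_of_add_eq_zero_left h)

theorem ne_neg_natCast_add {x : ℂ} (hx : ∀ n : ℕ, x ≠ -(n : ℂ)) (m n : ℕ) :
    x + m ≠ -(n : ℂ) := fun h => hx (m + n) (by push_cast; linear_combination h)

/-- The limit formula for the reciprocal Gamma function, valid also at its zeros. -/
theorem tendsto_poch_div_cpow (s : ℂ) :
    Tendsto (fun n : ℕ => poch s (n + 1) / ((n : ℂ) ^ s * n.factorial)) atTop
      (𝓝 (Complex.Gamma s)⁻¹) := by
  have hseq : ∀ n : ℕ, poch s (n + 1) / ((n : ℂ) ^ s * n.factorial)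
      = (Complex.GammaSeq s n)⁻¹ := fun n => by
    rw [Complex.GammaSeq, inv_div, poch]
  by_cases hs : ∃ k : ℕ, s = -(k : ℂ)
  · obtain ⟨k, rfl⟩ := hs
    rw [Complex.Gamma_neg_nat_eq_zero, inv_zero]
    refine tendsto_const_nhds.congr' ?_
    filter_upwards [eventually_ge_atTop k] with n hn
    have : poch (-(k : ℂ)) (n + 1) = 0 :=
      Finset.prod_eq_zero (Finset.mem_range.2 (Nat.lt_succ_of_le hn)) (by simp)
    rw [this, zero_div]
  · push Not at hs
    simp only [hseq]
    exact (Complex.GammaSeq_tendsto_Gamma s).inv₀ (Complex.Gamma_ne_zero hs)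

/-- The `(n + 1)`-st term of the well-poised series, with the removable singularity at `a = 0`
cancelled. -/
noncomputable def wellPoisedTerm (a b c : ℂ) (n : ℕ) : ℂ :=
  (-1) ^ (n + 1) * poch (a + 1) n * (a + 2 * n + 2) * poch b (n + 1) * poch c (n + 1)
    / ((n + 1).factorial * poch (1 + a - b) (n + 1) * poch (1 + a - c) (n + 1))

/-- The telescoping certificate relating the series at `a` and at `a + 1`. -/
noncomputable def wellPoisedCert (a b c : ℂ) (n : ℕ) : ℂ :=
  (-1) ^ n * poch (a + 1) n * poch b (n + 1) * poch c (n + 1)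
    / (n.factorial * poch (1 + a - b + 1) n * poch (1 + a - c + 1) n)

theorem wellPoisedTerm_sub (a b c : ℂ) (h2 : ∀ n : ℕ, 1 + a - b ≠ -(n : ℂ))
    (h3 : ∀ n : ℕ, 1 + a - c ≠ -(n : ℂ)) (n : ℕ) :
    (1 + a - b) * (1 + a - c) * wellPoisedTerm a b c n
      - (1 + a) * (1 + a - b - c) * wellPoisedTerm (a + 1) b c n
      = wellPoisedCert a b c (n + 1) - wellPoisedCert a b c n := by
  have hb0 : 1 + a - b ≠ 0 := by simpa using h2 0
  have hc0 : 1 + a - c ≠ 0 := by simpa using h3 0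
  have hb1 := poch_ne_zero (x := 1 + a - b + 1) (by simpa using ne_neg_natCast_add h2 1) n
  have hc1 := poch_ne_zero (x := 1 + a - c + 1) (by simpa using ne_neg_natCast_add h3 1) n
  have hb2 : 1 + a - b + 1 + n ≠ 0 := fun h => h2 (n + 1) (by push_cast; linear_combination h)
  have hc2 : 1 + a - c + 1 + n ≠ 0 := fun h => h3 (n + 1) (by push_cast; linear_combination h)
  have ha : (1 + a) * poch (a + 1 + 1) n = poch (a + 1) n * (a + 1 + n) := by
    rw [← poch_succ, poch_succ', add_comm 1 a]
  have hn : ((n : ℂ) + 1) ≠ 0 := Nat.cast_add_one_ne_zero n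
  have hf : (n.factorial : ℂ) ≠ 0 := Nat.cast_ne_zero.2 n.factorial_ne_zero
  have hR : (1 + a) * (1 + a - b - c) * wellPoisedTerm (a + 1) b c n
      = (-1) ^ (n + 1) * (poch (a + 1) n * (a + 1 + n)) * (1 + a - b - c) * (a + 1 + 2 * n + 2)
        * poch b (n + 1) * poch c (n + 1)
        / ((n + 1).factorial * (poch (1 + a - b + 1) n * (1 + a - b + 1 + n))
          * (poch (1 + a - c + 1) n * (1 + a - c + 1 + n))) := by
    rw [← ha, wellPoisedTerm, ← poch_succ, ← poch_succ,
      show 1 + (a + 1) - b = 1 + a - b + 1 by ring, show 1 + (a + 1) - c = 1 + a - c + 1 by ring]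
    ring
  rw [hR]
  simp only [wellPoisedTerm, wellPoisedCert, poch_succ' (1 + a - b) n, poch_succ' (1 + a - c) n,
    poch_succ b (n + 1), poch_succ c (n + 1), poch_succ (a + 1) n,
    poch_succ (1 + a - b + 1) n, poch_succ (1 + a - c + 1) n, Nat.factorial_succ]
  push_cast
  field_simp
  ring

theorem wellPoised_partial_sum (a b c : ℂ) (h2 : ∀ n : ℕ, 1 + a - b ≠ -(n : ℂ))
    (h3 : ∀ n : ℕ, 1 + a - c ≠ -(n : ℂ)) (N : ℕ) :
    (1 + a - b) * (1 + a - c) * (1 + ∑ n ∈ range N, wellPoisedTerm a b c n)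
      = (1 + a) * (1 + a - b - c) * (1 + ∑ n ∈ range N, wellPoisedTerm (a + 1) b c n)
        + wellPoisedCert a b c N := by
  have h := Finset.sum_range_sub (wellPoisedCert a b c) N
  rw [← Finset.sum_congr rfl fun n _ => wellPoisedTerm_sub a b c h2 h3 n, Finset.sum_sub_distrib,
    ← Finset.mul_sum, ← Finset.mul_sum] at h
  have h0 : wellPoisedCert a b c 0 = b * c := by simp [wellPoisedCert, poch]
  rw [h0] at h
  linear_combination h

theorem tendsto_wellPoisedCert (a b c : ℂ) (h2 : ∀ n : ℕ, 1 + a - b ≠ -(n : ℂ))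
    (h3 : ∀ n : ℕ, 1 + a - c ≠ -(n : ℂ)) (hre : 0 < (2 + a - 2 * b - 2 * c).re) :
    Tendsto (wellPoisedCert a b c) atTop (𝓝 0) := by
  have hΓb := inv_ne_zero (Complex.Gamma_ne_zero h2)
  have hΓc := inv_ne_zero (Complex.Gamma_ne_zero h3)
  have hlim := (((tendsto_poch_div_cpow (1 + a)).mul (tendsto_poch_div_cpow b)).mul
    (tendsto_poch_div_cpow c)).div ((tendsto_poch_div_cpow (1 + a - b)).mul
      (tendsto_poch_div_cpow (1 + a - c))) (mul_ne_zero hΓb hΓc)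
  have hpow : Tendsto (fun n : ℕ => (n : ℂ) ^ (-(2 + a - 2 * b - 2 * c))) atTop (𝓝 0) := by
    rw [tendsto_zero_iff_norm_tendsto_zero]
    refine ((tendsto_rpow_neg_atTop hre).comp tendsto_natCast_atTop_atTop).congr' ?_
    filter_upwards [eventually_gt_atTop 0] with n hn
    rw [Complex.norm_natCast_cpow_of_pos hn, Complex.neg_re, Function.comp_apply]
  have hinv : Tendsto (fun n : ℕ => (1 + a - b) * (1 + a - c) * (1 + (1 + a) / n : ℂ)⁻¹)
      atTop (𝓝 ((1 + a - b) * (1 + a - c) * (1 + 0 : ℂ)⁻¹)) :=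
    tendsto_const_nhds.mul ((tendsto_const_nhds.add
      (tendsto_const_div_atTop_nhds_zero_nat _)).inv₀ (by simp))
  rw [tendsto_zero_iff_norm_tendsto_zero]
  have hprod := ((hlim.mul hinv).mul hpow).norm
  rw [mul_zero, norm_zero] at hprod
  refine hprod.congr' ?_
  have hne : ∀ᶠ n : ℕ in atTop, 1 + a + n ≠ 0 :=
    ((tendsto_const_add_cobounded (1 + a)).comp tendsto_natCast_atTop_cobounded).eventually
      (Bornology.eventually_ne_cobounded 0)
  filter_upwards [hne, eventually_gt_atTop 0] with n han hn
  have hn' : (n : ℂ) ≠ 0 := Nat.cast_ne_zero.2 hn.ne'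
  have hf : (n.factorial : ℂ) ≠ 0 := Nat.cast_ne_zero.2 n.factorial_ne_zero
  have hb0 : 1 + a - b ≠ 0 := by simpa using h2 0
  have hc0 : 1 + a - c ≠ 0 := by simpa using h3 0
  have hb1 := poch_ne_zero (x := 1 + a - b + 1) (by simpa using ne_neg_natCast_add h2 1) n
  have hc1 := poch_ne_zero (x := 1 + a - c + 1) (by simpa using ne_neg_natCast_add h3 1) n
  have hp : ∀ s : ℂ, (n : ℂ) ^ s ≠ 0 := fun s => by simp [Complex.cpow_eq_zero_iff, hn']
  have hcpow : (n : ℂ) ^ (-(2 + a - 2 * b - 2 * c))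
      = (n : ℂ) ^ (1 + a) * (n : ℂ) ^ b * (n : ℂ) ^ c
        / ((n : ℂ) ^ (1 + a - b) * (n : ℂ) ^ (1 + a - c) * n) := by
    rw [eq_div_iff (by simp [hp, hn'])]
    nth_rw 4 [← Complex.cpow_one (n : ℂ)]
    simp only [← Complex.cpow_add _ _ hn']
    ring_nf
  have hinv' : (1 + (1 + a) / n : ℂ)⁻¹ = n / (1 + a + n) := by
    have : (1 + (1 + a) / n : ℂ) = (1 + a + n) / n := by
      field_simp
      ring
    rw [this, inv_div]
  have hcert : ‖wellPoisedCert a b c n‖ = ‖poch (1 + a) n * poch b (n + 1)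
      * poch c (n + 1) / (n.factorial * poch (1 + a - b + 1) n * poch (1 + a - c + 1) n)‖ := by
    simp [wellPoisedCert, add_comm a 1]
  rw [hcert]
  congr 1
  rw [hcpow, hinv', Pi.div_apply, poch_succ (1 + a), poch_succ' (1 + a - b), poch_succ' (1 + a - c)]
  have hp1 := hp (1 + a)
  have hp2 := hp b
  have hp3 := hp c
  have hp4 := hp (1 + a - b)
  have hp5 := hp (1 + a - c)
  generalize (n : ℂ) ^ (1 + a) = x₁ at *
  generalize (n : ℂ) ^ b = x₂ at *
  generalize (n : ℂ) ^ c = x₃ at *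
  generalize (n : ℂ) ^ (1 + a - b) = x₄ at *
  generalize (n : ℂ) ^ (1 + a - c) = x₅ at *
  field_simp

theorem tendsto_wellPoised_of_succ {a b c l : ℂ} (h2 : ∀ n : ℕ, 1 + a - b ≠ -(n : ℂ))
    (h3 : ∀ n : ℕ, 1 + a - c ≠ -(n : ℂ)) (hre : 0 < (2 + a - 2 * b - 2 * c).re)
    (h : Tendsto (fun N => 1 + ∑ n ∈ range N, wellPoisedTerm (a + 1) b c n) atTop (𝓝 l)) :
    Tendsto (fun N => 1 + ∑ n ∈ range N, wellPoisedTerm a b c n) atTop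
      (𝓝 ((1 + a) * (1 + a - b - c) / ((1 + a - b) * (1 + a - c)) * l)) := by
  have hb0 : 1 + a - b ≠ 0 := by simpa using h2 0
  have hc0 : 1 + a - c ≠ 0 := by simpa using h3 0
  have h := ((h.const_mul ((1 + a) * (1 + a - b - c))).add
    (tendsto_wellPoisedCert a b c h2 h3 hre)).div_const ((1 + a - b) * (1 + a - c))
  rw [add_zero, mul_div_right_comm] at h
  refine h.congr fun N => ?_
  rw [← wellPoised_partial_sum a b c h2 h3 N, mul_div_cancel_left₀ _ (mul_ne_zero hb0 hc0)]

theorem tendsto_wellPoised_of_add {a b c : ℂ} (h2 : ∀ n : ℕ, 1 + a - b ≠ -(n : ℂ))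
    (h3 : ∀ n : ℕ, 1 + a - c ≠ -(n : ℂ)) (hre : 0 < (2 + a - 2 * b - 2 * c).re) (m : ℕ) {l : ℂ}
    (h : Tendsto (fun N => 1 + ∑ n ∈ range N, wellPoisedTerm (a + m) b c n) atTop (𝓝 l)) :
    Tendsto (fun N => 1 + ∑ n ∈ range N, wellPoisedTerm a b c n) atTop
      (𝓝 (poch (1 + a) m * poch (1 + a - b - c) m / (poch (1 + a - b) m * poch (1 + a - c) m)
        * l)) := by
  induction m generalizing l with
  | zero => simpa [poch] using h
  | succ m ih =>
    have hb : ∀ n : ℕ, 1 + (a + m) - b ≠ -(n : ℂ) := fun n => by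
      rw [show 1 + (a + m) - b = 1 + a - b + m by ring]; exact ne_neg_natCast_add h2 m n
    have hc : ∀ n : ℕ, 1 + (a + m) - c ≠ -(n : ℂ) := fun n => by
      rw [show 1 + (a + m) - c = 1 + a - c + m by ring]; exact ne_neg_natCast_add h3 m n
    have hre' : 0 < (2 + (a + m) - 2 * b - 2 * c).re := by
      have : (0 : ℝ) ≤ m := m.cast_nonneg
      simp at hre ⊢
      linarith
    rw [Nat.cast_succ, ← add_assoc] at h
    convert ih (tendsto_wellPoised_of_succ hb hc hre' h) using 2
    simp only [poch_succ, div_eq_mul_inv, mul_inv]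
    rw [show 1 + (a + m) = 1 + a + m by ring, show 1 + a + m - b = 1 + a - b + m by ring,
      show 1 + a + m - c = 1 + a - c + m by ring,
      show 1 + a - b + m - c = 1 + a - b - c + m by ring]
    ring

theorem tendsto_poch_ratio (a b c : ℂ) (h2 : ∀ n : ℕ, 1 + a - b ≠ -(n : ℂ))
    (h3 : ∀ n : ℕ, 1 + a - c ≠ -(n : ℂ)) :
    Tendsto (fun m => poch (1 + a) m * poch (1 + a - b - c) m
        / (poch (1 + a - b) m * poch (1 + a - c) m)) atTop
      (𝓝 (Complex.Gamma (1 + a - b) * Complex.Gamma (1 + a - c)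
        / (Complex.Gamma (1 + a) * Complex.Gamma (1 + a - b - c)))) := by
  have hΓb := inv_ne_zero (Complex.Gamma_ne_zero h2)
  have hΓc := inv_ne_zero (Complex.Gamma_ne_zero h3)
  have hlim := ((tendsto_poch_div_cpow (1 + a)).mul (tendsto_poch_div_cpow (1 + a - b - c))).div
    ((tendsto_poch_div_cpow (1 + a - b)).mul (tendsto_poch_div_cpow (1 + a - c)))
      (mul_ne_zero hΓb hΓc)
  rw [← tendsto_add_atTop_iff_nat 1]
  convert hlim.congr' ?_ using 2
  · simp only [div_eq_mul_inv, mul_inv, inv_inv]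
    ring
  filter_upwards [eventually_gt_atTop 0] with n hn
  have hn' : (n : ℂ) ≠ 0 := Nat.cast_ne_zero.2 hn.ne'
  have hf : (n.factorial : ℂ) ≠ 0 := Nat.cast_ne_zero.2 n.factorial_ne_zero
  have hcpow : (n : ℂ) ^ (1 + a) * (n : ℂ) ^ (1 + a - b - c)
      = (n : ℂ) ^ (1 + a - b) * (n : ℂ) ^ (1 + a - c) := by
    rw [← Complex.cpow_add _ _ hn', ← Complex.cpow_add _ _ hn']
    ring_nf
  have hp : ∀ s : ℂ, (n : ℂ) ^ s ≠ 0 := fun s => by simp [Complex.cpow_eq_zero_iff, hn']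
  have hB := poch_ne_zero h2 (n + 1)
  have hC := poch_ne_zero h3 (n + 1)
  have e : ∀ p q r s x y z w f : ℂ, x * y = z * w → x ≠ 0 → y ≠ 0 → f ≠ 0 →
      p / (x * f) * (q / (y * f)) / (r / (z * f) * (s / (w * f))) = p * q / (r * s) := by
    intro p q r s x y z w f h hx hy hf
    rw [div_mul_div_comm, div_mul_div_comm, mul_mul_mul_comm x, mul_mul_mul_comm z, ← h,
      div_div_div_cancel_right₀ (by positivity)]
  exact e _ _ _ _ _ _ _ _ _ hcpow (hp _) (hp _) hf

theorem wellPoisedTerm_succ (a b c : ℂ) {n : ℕ} (h : a + 2 * n + 2 ≠ 0) :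
    wellPoisedTerm a b c (n + 1) = -wellPoisedTerm a b c n
      * ((a + (n + 1)) * (a + 2 * (n + 1) + 2) * (b + (n + 1)) * (c + (n + 1))
        / ((a + 2 * n + 2) * (n + 1 + 1) * (1 + a - b + (n + 1)) * (1 + a - c + (n + 1)))) := by
  simp only [wellPoisedTerm, poch_succ _ (n + 1), poch_succ (a + 1) n, Nat.factorial_succ (n + 1)]
  push_cast
  simp only [div_eq_mul_inv, mul_inv]
  have h' := mul_inv_cancel₀ h
  refine ((mul_one _).symm.trans (congrArg _ h'.symm)).trans ?_
  ring

theorem ratio_bound {D m k : ℝ} (hD : 0 ≤ D) (hk : 1 ≤ k)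
    (hm : 3 * (2 * D + D ^ 2) + 2 + 5 * D ≤ m) :
    (m + k + D) * (m + 2 * k + D) * (k + D) * (k + D) * (k + 2)
      ≤ k * ((m + 2 * k - D) * (k + 1) * (m + k - D) * (m + k - D)) := by
  set E := 2 * D + D ^ 2 with hE
  obtain ⟨y, rfl⟩ : ∃ y, m = y + D - k := ⟨m + k - D, by ring⟩
  have hE0 : 0 ≤ E := by positivity
  have hy : k + (3 * E + 2) + 4 * D ≤ y := by linarith
  have hy0 : 0 ≤ y := by nlinarith
  have e1 : (k + D) * (k + D) * (k + 2) ≤ (k + 1) * (k * (k + (3 * E + 2))) := by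
    calc (k + D) * (k + D) * (k + 2) ≤ (k + 1) * (k + E) * (k + 2) := by
          have : (k + D) * (k + D) ≤ (k + 1) * (k + E) := by nlinarith
          gcongr ?_ * _
      _ = (k + 1) * ((k + E) * (k + 2)) := by ring
      _ ≤ _ := by
          have : (k + E) * (k + 2) ≤ k * (k + (3 * E + 2)) := by nlinarith
          gcongr ?_ * ?_
  have e2 : (y + 2 * D) * (y + 2 * D) * (k + (3 * E + 2)) ≤ y ^ 3 := by
    calc _ ≤ (y + 2 * D) * (y + 2 * D) * (y - 4 * D) := by gcongr; linarith
      _ ≤ y ^ 3 := by nlinarith [mul_nonneg (sq_nonneg D) hy0, pow_nonneg hD 3]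
  have e3 : y * (y + k + 2 * D) ≤ (y + 2 * D) * (y + k) := by nlinarith
  rcases hy0.eq_or_lt with h | hy1
  · nlinarith
  refine le_of_mul_le_mul_left ?_ hy1
  calc _ = (y + 2 * D) * (y * (y + k + 2 * D)) * ((k + D) * (k + D) * (k + 2)) := by ring
    _ ≤ (y + 2 * D) * ((y + 2 * D) * (y + k)) * ((k + 1) * (k * (k + (3 * E + 2)))) := by gcongr
    _ = (y + 2 * D) * (y + 2 * D) * (k + (3 * E + 2)) * ((y + k) * (k + 1) * k) := by ring
    _ ≤ y ^ 3 * ((y + k) * (k + 1) * k) := by gcongr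
    _ = _ := by ring

theorem norm_wellPoisedTerm_succ_le (a b c : ℂ) : ∀ᶠ m : ℕ in atTop, ∀ n : ℕ,
    ‖wellPoisedTerm (a + m) b c (n + 1)‖ * (n + 3) ≤ ‖wellPoisedTerm (a + m) b c n‖ * (n + 1) := by
  set D : ℝ := ‖a‖ + 2 + ‖b‖ + ‖c‖ with hD
  have ha := norm_nonneg a
  have hb := norm_nonneg b
  have hc := norm_nonneg c
  have hD0 : 0 ≤ D := by positivity
  have upper : ∀ {z : ℂ} {x : ℝ}, ‖z‖ ≤ D → 0 ≤ x → ‖z + x‖ ≤ x + D := fun {z x} hz hx => by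
    have := norm_add_le z x
    rw [Complex.norm_of_nonneg hx] at this
    linarith
  have lower : ∀ {z : ℂ} {x : ℝ}, ‖z‖ ≤ D → 0 ≤ x → x - D ≤ ‖z + x‖ := fun {z x} hz hx => by
    have := norm_sub_norm_le (x : ℂ) (-z)
    rw [Complex.norm_of_nonneg hx, norm_neg, sub_neg_eq_add, add_comm (x : ℂ)] at this
    linarith
  have hone : ∀ z : ℂ, ‖1 + a - z‖ ≤ 1 + ‖a‖ + ‖z‖ := fun z => by
    simpa using (norm_sub_le (1 + a) z).trans (add_le_add_left (norm_add_le 1 a) _)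
  have htwo : ‖a + 2‖ ≤ ‖a‖ + 2 := by simpa using norm_add_le a 2
  filter_upwards [eventually_ge_atTop ⌈3 * (2 * D + D ^ 2) + 2 + 5 * D⌉₊] with m hm n
  have hm' : 3 * (2 * D + D ^ 2) + 2 + 5 * D ≤ m := Nat.ceil_le.1 hm
  have hk : (1 : ℝ) ≤ n + 1 := by simp
  have hm0 : (0 : ℝ) ≤ m := m.cast_nonneg
  have hmD : 0 < (m : ℝ) - D := by nlinarith
  have u1 : ‖a + m + (n + 1)‖ ≤ m + (n + 1) + D := by
    convert upper (z := a) (x := m + (n + 1)) (by linarith) (by positivity) using 2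
    push_cast; ring
  have u2 : ‖a + m + 2 * (n + 1) + 2‖ ≤ m + 2 * (n + 1) + D := by
    convert upper (z := a + 2) (x := m + 2 * (n + 1)) (by linarith) (by positivity) using 2
    push_cast; ring
  have u3 : ‖b + (n + 1)‖ ≤ n + 1 + D := by
    simpa using upper (z := b) (x := n + 1) (by linarith) (by positivity)
  have u4 : ‖c + (n + 1)‖ ≤ n + 1 + D := by
    simpa using upper (z := c) (x := n + 1) (by linarith) (by positivity)
  have l1 : m + 2 * (n + 1) - D ≤ ‖a + m + 2 * n + 2‖ := by
    convert lower (z := a) (x := m + 2 * (n + 1)) (by linarith) (by positivity) using 2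
    push_cast; ring
  have l2 : m + (n + 1) - D ≤ ‖1 + (a + m) - b + (n + 1)‖ := by
    convert lower (z := 1 + a - b) (x := m + (n + 1)) (by linarith [hone b]) (by positivity) using 2
    push_cast; ring
  have l3 : m + (n + 1) - D ≤ ‖1 + (a + m) - c + (n + 1)‖ := by
    convert lower (z := 1 + a - c) (x := m + (n + 1)) (by linarith [hone c]) (by positivity) using 2
    push_cast; ring
  have l4 : ‖(n + 1 + 1 : ℂ)‖ = n + 1 + 1 := by
    simpa using Complex.norm_of_nonneg (show (0 : ℝ) ≤ n + 1 + 1 by positivity)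
  have p1 : 0 < m + 2 * (n + 1) - D := by linarith
  have p2 : 0 < m + (n + 1) - D := by linarith
  rw [wellPoisedTerm_succ _ _ _ (norm_pos_iff.1 (p1.trans_le l1)), norm_mul, norm_neg, mul_assoc]
  refine mul_le_mul_of_nonneg_left ?_ (norm_nonneg _)
  simp only [norm_div, norm_mul, l4]
  have hden : 0 < ‖a + m + 2 * n + 2‖ * (n + 1 + 1) * ‖1 + (a + m) - b + (n + 1)‖
      * ‖1 + (a + m) - c + (n + 1)‖ := by
    have := p1.trans_le l1
    have := p2.trans_le l2
    have := p2.trans_le l3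
    positivity
  rw [div_mul_eq_mul_div, div_le_iff₀ hden]
  calc _ ≤ (m + (n + 1) + D) * (m + 2 * (n + 1) + D) * (n + 1 + D) * (n + 1 + D)
        * ((n : ℝ) + 1 + 2) := by
        rw [show (n : ℝ) + 3 = n + 1 + 2 by ring]
        gcongr
    _ ≤ (n + 1) * ((m + 2 * (n + 1) - D) * (n + 1 + 1) * (m + (n + 1) - D) * (m + (n + 1) - D)) :=
        ratio_bound hD0 hk hm'
    _ ≤ _ := by gcongr

theorem norm_le_of_ratio_le {u : ℕ → ℂ} (h : ∀ n : ℕ, ‖u (n + 1)‖ * (n + 3) ≤ ‖u n‖ * (n + 1))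
    (n : ℕ) : ‖u n‖ ≤ 2 * ‖u 0‖ * (1 / ((n + 1 : ℝ) * (n + 2))) := by
  induction n with
  | zero => norm_num; linarith
  | succ n ih =>
    have h1 := (h n).trans (mul_le_mul_of_nonneg_right ih (by positivity))
    rw [← le_div_iff₀ (by positivity)] at h1
    refine h1.trans (le_of_eq ?_)
    push_cast
    field_simp
    ring

theorem hasSum_one_div_mul_succ : HasSum (fun n : ℕ => 1 / ((n + 1 : ℝ) * (n + 2))) 1 := by
  rw [hasSum_iff_tendsto_nat_of_nonneg fun n => by positivity]
  have hsum : ∀ N : ℕ, ∑ n ∈ range N, 1 / ((n + 1 : ℝ) * (n + 2)) = 1 - 1 / (N + 1 : ℝ) := by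
    intro N
    induction N with
    | zero => simp
    | succ N ih =>
      rw [Finset.sum_range_succ, ih]
      push_cast
      field_simp
      ring
  simp only [hsum]
  simpa using tendsto_const_nhds.sub (tendsto_one_div_add_atTop_nhds_zero_nat (𝕜 := ℝ))

theorem tendsto_wellPoisedTerm_zero (a b c : ℂ) :
    Tendsto (fun m : ℕ => wellPoisedTerm (a + m) b c 0) atTop (𝓝 0) := by
  have hinf : ∀ s : ℂ, Tendsto (fun m : ℕ => (s + m)⁻¹) atTop (𝓝 0) := fun s =>
    tendsto_inv₀_cobounded.comp
      ((tendsto_const_add_cobounded s).comp tendsto_natCast_atTop_cobounded)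
  have h := (((hinf (1 + a - c)).const_mul (-(b * c))).add
    (((hinf (1 + a - b)).mul (hinf (1 + a - c))).const_mul (-(b * c * (1 + b)))))
  simp only [mul_zero, add_zero] at h
  refine h.congr' ?_
  have hne : ∀ s : ℂ, ∀ᶠ m : ℕ in atTop, s + m ≠ 0 := fun s =>
    ((tendsto_const_add_cobounded s).comp tendsto_natCast_atTop_cobounded).eventually
      (Bornology.eventually_ne_cobounded 0)
  filter_upwards [hne (1 + a - b), hne (1 + a - c)] with m hb hc
  simp only [wellPoisedTerm, poch, zero_add, Finset.prod_range_one, Finset.prod_range_zero]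
  rw [show 1 + (a + m) - b = 1 + a - b + m by ring, show 1 + (a + m) - c = 1 + a - c + m by ring]
  simp only [Nat.cast_zero, add_zero, Nat.factorial_one, Nat.cast_one]
  field_simp
  ring

theorem tendsto_wellPoised (a b c : ℂ)
    (h2 : ∀ n : ℕ, 1 + a - b ≠ -(n : ℂ)) (h3 : ∀ n : ℕ, 1 + a - c ≠ -(n : ℂ))
    (hre : 0 < (2 + a - 2 * b - 2 * c).re) :
    Tendsto (fun N => 1 + ∑ n ∈ range N, wellPoisedTerm a b c n) atTop
      (𝓝 (Complex.Gamma (1 + a - b) * Complex.Gamma (1 + a - c)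
          / (Complex.Gamma (1 + a) * Complex.Gamma (1 + a - b - c)))) := by
  have hev := norm_wellPoisedTerm_succ_le a b c
  set s : ℕ → ℂ := fun m => ∑' n, wellPoisedTerm (a + m) b c n
  have hbound : ∀ᶠ m : ℕ in atTop, ‖s m‖ ≤ 2 * ‖wellPoisedTerm (a + m) b c 0‖ := by
    filter_upwards [hev] with m hm
    simpa using tsum_of_norm_bounded (hasSum_one_div_mul_succ.mul_left _) (norm_le_of_ratio_le hm)
  have hs : Tendsto s atTop (𝓝 0) := by
    refine squeeze_zero_norm' hbound ?_
    simpa using (tendsto_wellPoisedTerm_zero a b c).norm.const_mul 2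
  have hlim : ∀ᶠ m : ℕ in atTop, Tendsto (fun N => 1 + ∑ n ∈ range N, wellPoisedTerm a b c n) atTop
      (𝓝 (poch (1 + a) m * poch (1 + a - b - c) m / (poch (1 + a - b) m * poch (1 + a - c) m)
        * (1 + s m))) := by
    filter_upwards [hev] with m hm
    refine tendsto_wellPoised_of_add h2 h3 hre m (tendsto_const_nhds.add ?_)
    exact (Summable.of_norm_bounded (hasSum_one_div_mul_succ.mul_left _).summable
      (norm_le_of_ratio_le hm)).hasSum.tendsto_sum_nat
  obtain ⟨m₀, hm₀⟩ := hlim.exists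
  have hR := (tendsto_poch_ratio a b c h2 h3).mul (hs.const_add 1)
  rw [add_zero, mul_one] at hR
  rwa [tendsto_nhds_unique (hR.congr' (hlim.mono fun m hm => tendsto_nhds_unique hm hm₀))
    tendsto_const_nhds]

theorem wellPoised_4F3_neg_one (a b c : ℂ)
    (h1 : ∀ n : ℕ, a/2 ≠ -(n : ℂ)) (h2 : ∀ n : ℕ, 1 + a - b ≠ -(n : ℂ))
    (h3 : ∀ n : ℕ, 1 + a - c ≠ -(n : ℂ)) (hre : 0 < (2 + a - 2*b - 2*c).re) :
    limUnder atTop (fun N => ∑ n ∈ Finset.range N,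
        (-1 : ℂ)^n * poch a n * poch (1 + a/2) n * poch b n * poch c n
          / ((n.factorial : ℂ) * poch (a/2) n * poch (1 + a - b) n * poch (1 + a - c) n))
      = Complex.Gamma (1 + a - b) * Complex.Gamma (1 + a - c)
          / (Complex.Gamma (1 + a) * Complex.Gamma (1 + a - b - c)) := by
  apply Tendsto.limUnder_eq
  rw [← tendsto_add_atTop_iff_nat 1]
  refine (tendsto_wellPoised a b c h2 h3 hre).congr fun N => ?_
  rw [Finset.sum_range_succ', add_comm]
  congr 1
  · refine Finset.sum_congr rfl fun n _ => ?_
    have ha : a / 2 ≠ 0 := by simpa using h1 0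
    have hp : poch (1 + a / 2) n ≠ 0 := by
      rw [add_comm]
      exact poch_ne_zero (by simpa using ne_neg_natCast_add h1 1) n
    have hb := poch_ne_zero h2 (n + 1)
    have hc := poch_ne_zero h3 (n + 1)
    have hf : ((n + 1).factorial : ℂ) ≠ 0 := Nat.cast_ne_zero.2 (n + 1).factorial_ne_zero
    have ha' : a ≠ 0 := by simpa using ha
    rw [wellPoisedTerm, poch_succ' a, poch_succ (1 + a / 2), poch_succ' (a / 2), add_comm (a / 2) 1]
    generalize poch (1 + a / 2) n = p at hp
    field_simp
    ring
  · simp [poch]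
end

section
/- For nonnegative integers a, b with K = a + b + 1, Zagier's formula holds: H(a,b) = 2 Σ_{r=1}^K (-1)^r [C(2r, 2a+2) ζ(2r+1) + C(2r, 2b+1) ζ(overline{2r+1})] H(K-r), where H(a,b) = ζ(2^a, 3, 2^b), H(n) = ζ(2^n) = π^{2n}/(2n+1)!, and ζ(overline{k}) = -(1-2^{1-k})ζ(k). -/
open Filter Finset Real

/-- Multiple zeta star value `ζ*(k₁,…,k_n) = Σ_{1 ≤ m₁ ≤ … ≤ m_n} ∏ 1/m_i^{k_i}`. -/
noncomputable def mzvStar (n : ℕ) (k : Fin n → ℕ) : ℝ :=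
  ∑' m : {f : Fin n → ℕ+ // Monotone f}, ∏ i, (1 : ℝ)/((m.1 i : ℝ))^(k i)

/-- Multiple zeta value `ζ(k₁,…,k_n) = Σ_{1 ≤ m₁ < … < m_n} ∏ 1/m_i^{k_i}`. -/
noncomputable def mzv (n : ℕ) (k : Fin n → ℕ) : ℝ :=
  ∑' m : {f : Fin n → ℕ+ // StrictMono f}, ∏ i, (1 : ℝ)/((m.1 i : ℝ))^(k i)

/-- The exponent string `(2,…,2,3,2,…,2)` with `a` twos before the `3` and `b` twos after. -/
def expo232 (a b : ℕ) : Fin (a+b+1) → ℕ := fun i => if (i : ℕ) = a then 3 else 2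

/-- `H*(a,b) = ζ*(2^a, 3, 2^b)`. -/
noncomputable def Hstar (a b : ℕ) : ℝ := mzvStar (a+b+1) (expo232 a b)

/-- `H*(n) = ζ*(2^n)` (so `H*(0) = 1`). -/
noncomputable def HstarN (n : ℕ) : ℝ := mzvStar n (fun _ => 2)

/-- `H(a,b) = ζ(2^a, 3, 2^b)`. -/
noncomputable def Hmzv (a b : ℕ) : ℝ := mzv (a+b+1) (expo232 a b)

/-- `H(n) = ζ(2^n)` (so `H(0) = 1`). -/
noncomputable def HmzvN (n : ℕ) : ℝ := mzv n (fun _ => 2)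

/-- The Wallis product `4 ^ n / C(2 * n, n)`. -/
noncomputable def wallisCoeff (n : ℕ) : ℝ := ∏ i ∈ range n, (2 * (i : ℝ) + 2) / (2 * i + 1)

/-- The normalised even power `4 ^ n / C(2 * n, n) * sin x ^ (2 * n)`. -/
noncomputable def sinPow (n : ℕ) (x : ℝ) : ℝ := wallisCoeff n * sin x ^ (2 * n)

/-- The derivative of `sinPow (n + 1)`. -/
noncomputable def sinPowDeriv (n : ℕ) (x : ℝ) : ℝ :=
  wallisCoeff (n + 1) * ((2 * n + 2) * (sin x ^ (2 * n + 1) * cos x))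

/-- The tail `ζ(2, …, 2)` (`b` twos) over summation indices larger than `n`, as an integral. -/
noncomputable def tailTwos (b n : ℕ) : ℝ :=
  2 / π * ∫ x in (0 : ℝ)..(π / 2), (π - 2 * x) ^ (2 * b) / (2 * b).factorial * sinPow n x

/-- The elementary symmetric sum `∑_{1 ≤ m₁ < … < m_a ≤ n} ∏ 1 / m_i ^ 2`. -/
noncomputable def headTwos : ℕ → ℕ → ℝ
  | 0, _ => 1
  | a + 1, n => ∑ i ∈ range n, headTwos a i / ((i : ℝ) + 1) ^ 2

lemma wallisCoeff_pos (n : ℕ) : 0 < wallisCoeff n :=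
  prod_pos fun i _ => by positivity

lemma wallisCoeff_succ (n : ℕ) :
    wallisCoeff (n + 1) = wallisCoeff n * ((2 * n + 2) / (2 * n + 1)) := by
  rw [wallisCoeff, wallisCoeff, prod_range_succ]

lemma wallisCoeff_le (n : ℕ) : wallisCoeff n ≤ 2 * n + 1 := by
  induction n with
  | zero => simp [wallisCoeff]
  | succ n ih =>
    rw [wallisCoeff_succ, mul_div_assoc', div_le_iff₀ (by positivity)]
    push_cast
    nlinarith

lemma sinPow_zero (x : ℝ) : sinPow 0 x = 1 := by simp [sinPow, wallisCoeff]

lemma sinPow_nonneg (n : ℕ) (x : ℝ) : 0 ≤ sinPow n x :=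
  mul_nonneg (wallisCoeff_pos n).le (by rw [pow_mul]; positivity)

@[fun_prop]
lemma continuous_sinPow (n : ℕ) : Continuous (sinPow n) := by
  unfold sinPow; fun_prop

@[fun_prop]
lemma continuous_sinPowDeriv (n : ℕ) : Continuous (sinPowDeriv n) := by
  unfold sinPowDeriv; fun_prop

lemma hasDerivAt_sinPow (n : ℕ) (x : ℝ) :
    HasDerivAt (sinPow (n + 1)) (sinPowDeriv n x) x := by
  have h := ((hasDerivAt_sin x).pow (2 * (n + 1))).const_mul (wallisCoeff (n + 1))
  refine h.congr_deriv ?_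
  rw [sinPowDeriv, show 2 * (n + 1) - 1 = 2 * n + 1 by lia]
  push_cast
  ring

lemma hasDerivAt_sinPowDeriv (n : ℕ) (x : ℝ) :
    HasDerivAt (sinPowDeriv n) (4 * ((n : ℝ) + 1) ^ 2 * (sinPow n x - sinPow (n + 1) x)) x := by
  have h := ((((hasDerivAt_sin x).pow (2 * n + 1)).mul (hasDerivAt_cos x)).const_mul
    (2 * (n : ℝ) + 2)).const_mul (wallisCoeff (n + 1))
  refine h.congr_deriv ?_
  have hc : wallisCoeff n * (2 * n + 2) = wallisCoeff (n + 1) * (2 * n + 1) := by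
    rw [wallisCoeff_succ]; field_simp
  have hs : cos x ^ 2 = 1 - sin x ^ 2 := by rw [cos_sq']
  simp only [sinPow, Pi.pow_apply, Nat.add_sub_cancel]
  push_cast
  rw [show 2 * (n + 1) = 2 * n + 2 by ring]
  linear_combination (wallisCoeff (n + 1) * (2 * n + 2) * (2 * n + 1) * sin x ^ (2 * n)) * hs
    - (2 * n + 2) * sin x ^ (2 * n) * hc

lemma hasDerivAt_pi_sub_pow (k : ℕ) (x : ℝ) :
    HasDerivAt (fun x : ℝ => (π - 2 * x) ^ (k + 1) / (k + 1).factorial)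
      (-2 * ((π - 2 * x) ^ k / k.factorial)) x := by
  have h := ((((hasDerivAt_id x).const_mul 2).const_sub π).pow (k + 1)).div_const
    ((k + 1).factorial : ℝ)
  refine h.congr_deriv ?_
  have : (k.factorial : ℝ) ≠ 0 := by positivity
  rw [Nat.factorial_succ]
  push_cast
  field_simp
  simp

lemma tailTwos_zero_left (n : ℕ) : tailTwos 0 n = 1 := by
  induction n with
  | zero =>
    simp [tailTwos, sinPow_zero]
  | succ n ih =>
    rw [← ih]
    have h := intervalIntegral.integral_eq_sub_of_hasDerivAt (a := 0) (b := π / 2)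
      (fun x _ => hasDerivAt_sinPowDeriv n x) (Continuous.intervalIntegrable (by fun_prop) _ _)
    rw [intervalIntegral.integral_const_mul, intervalIntegral.integral_sub
      ((continuous_sinPow _).intervalIntegrable _ _)
      ((continuous_sinPow _).intervalIntegrable _ _)] at h
    simp only [sinPowDeriv, cos_pi_div_two, sin_zero] at h
    simp at h
    have h' := h.resolve_left (by positivity)
    simp only [tailTwos]
    simp
    linarith

lemma tailTwos_sub (b n : ℕ) :
    tailTwos (b + 1) n - tailTwos (b + 1) (n + 1) = tailTwos b (n + 1) / ((n : ℝ) + 1) ^ 2 := by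
  set q : ℕ → ℝ → ℝ := fun k x => (π - 2 * x) ^ k / k.factorial with hq
  have hqc (k : ℕ) : Continuous (q k) := by simp only [hq]; fun_prop
  have hG (x : ℝ) : HasDerivAt
      (fun x => q (2 * b + 2) x * sinPowDeriv n x + 2 * (q (2 * b + 1) x * sinPow (n + 1) x))
      (4 * ((n : ℝ) + 1) ^ 2 * (q (2 * b + 2) x * sinPow n x - q (2 * b + 2) x * sinPow (n + 1) x)
        - 4 * (q (2 * b) x * sinPow (n + 1) x)) x := by
    have h := ((hasDerivAt_pi_sub_pow (2 * b + 1) x).mul (hasDerivAt_sinPowDeriv n x)).add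
      (((hasDerivAt_pi_sub_pow (2 * b) x).mul (hasDerivAt_sinPow n x)).const_mul 2)
    refine h.congr_deriv ?_
    simp only [hq]
    ring
  have h := intervalIntegral.integral_eq_sub_of_hasDerivAt (a := 0) (b := π / 2)
      (fun x _ => hG x) (Continuous.intervalIntegrable (by fun_prop) _ _)
  rw [intervalIntegral.integral_sub (Continuous.intervalIntegrable (by fun_prop) _ _)
    (Continuous.intervalIntegrable (by fun_prop) _ _), intervalIntegral.integral_const_mul,
    intervalIntegral.integral_const_mul,
    intervalIntegral.integral_sub (Continuous.intervalIntegrable (by fun_prop) _ _)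
    (Continuous.intervalIntegrable (by fun_prop) _ _)] at h
  have h0 : π - 2 * (π / 2) = 0 := by ring
  simp only [hq, sinPowDeriv, sinPow, sin_zero, h0] at h
  simp at h
  rw [eq_div_iff (by positivity)]
  simp only [tailTwos, sinPow]
  linear_combination (2 / π / 4) * h

lemma tailTwos_nonneg (b n : ℕ) : 0 ≤ tailTwos b n := by
  refine mul_nonneg (by positivity) (intervalIntegral.integral_nonneg (by positivity) fun x _ => ?_)
  have := sinPow_nonneg n x
  rw [pow_mul]
  positivity

lemma integral_sinPow (n : ℕ) : ∫ x in (0 : ℝ)..(π / 2), sinPow n x = π / 2 := by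
  have h := tailTwos_zero_left n
  simp only [tailTwos] at h
  simp at h
  field_simp at h
  linarith

lemma integral_sinPow_mul_cos_sq (n : ℕ) :
    ∫ x in (0 : ℝ)..(π / 2), sinPow n x * cos x ^ 2 = π / 2 / (2 * n + 2) := by
  have hc : wallisCoeff (n + 1) * (2 * n + 1) = wallisCoeff n * (2 * n + 2) := by
    rw [wallisCoeff_succ]; field_simp
  have (x : ℝ) : sinPow n x * cos x ^ 2
      = sinPow n x - (2 * n + 1) / (2 * n + 2) * sinPow (n + 1) x := by
    simp only [sinPow, cos_sq']
    field_simp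
    rw [show 2 * (n + 1) = 2 * n + 2 by ring]
    linear_combination (sin x ^ (2 * n + 2)) * hc
  simp only [this]
  rw [intervalIntegral.integral_sub (Continuous.intervalIntegrable (by fun_prop) _ _)
    (Continuous.intervalIntegrable (by fun_prop) _ _), intervalIntegral.integral_const_mul,
    integral_sinPow, integral_sinPow]
  field_simp
  ring

lemma tailTwos_le (b n : ℕ) : tailTwos (b + 1) n ≤ π ^ (2 * b + 2) / (2 * n + 2) := by
  have hle : ∫ x in (0 : ℝ)..(π / 2),
      (π - 2 * x) ^ (2 * (b + 1)) / (2 * (b + 1)).factorial * sinPow n x ≤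
      ∫ x in (0 : ℝ)..(π / 2), π ^ (2 * b + 2) * (sinPow n x * cos x ^ 2) := by
    refine intervalIntegral.integral_mono_on (by positivity)
      (Continuous.intervalIntegrable (by fun_prop) _ _)
      (Continuous.intervalIntegrable (by fun_prop) _ _) fun x hx => ?_
    have hcos : π - 2 * x ≤ π * cos x := by
      have := mul_le_sin (x := π / 2 - x) (by linarith [hx.2]) (by linarith [hx.1])
      rw [sin_pi_div_two_sub, div_mul_eq_mul_div, div_le_iff₀ pi_pos] at this
      linarith
    have hcos0 : 0 ≤ cos x := cos_nonneg_of_mem_Icc ⟨by linarith [hx.1, pi_pos], hx.2⟩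
    have h1 : (π - 2 * x) ^ (2 * (b + 1)) / (2 * (b + 1)).factorial
        ≤ π ^ (2 * b + 2) * cos x ^ 2 := by
      calc _ ≤ (π - 2 * x) ^ (2 * (b + 1)) := by
            refine div_le_self (by rw [pow_mul]; positivity) ?_
            exact_mod_cast Nat.factorial_pos _
        _ ≤ (π * cos x) ^ (2 * (b + 1)) := by
            gcongr
            linarith [hx.2]
        _ = π ^ (2 * b + 2) * cos x ^ (2 * b + 2) := by rw [mul_pow]; rfl
        _ ≤ _ := by
            exact mul_le_mul_of_nonneg_left
              (pow_le_pow_of_le_one hcos0 (cos_le_one x) (Nat.le_add_left 2 (2 * b)))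
              (by positivity)
    calc _ ≤ π ^ (2 * b + 2) * cos x ^ 2 * sinPow n x := by
          gcongr
          exact sinPow_nonneg n x
      _ = _ := by ring
  rw [intervalIntegral.integral_const_mul, integral_sinPow_mul_cos_sq] at hle
  calc tailTwos (b + 1) n ≤ 2 / π * (π ^ (2 * b + 2) * (π / 2 / (2 * n + 2))) := by
        unfold tailTwos; gcongr
    _ = _ := by field_simp

lemma hasSum_tailTwos (b n : ℕ) :
    HasSum (fun m : ℕ => tailTwos b (n + m + 1) / ((n : ℝ) + m + 1) ^ 2) (tailTwos (b + 1) n) := by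
  have hlim : Tendsto (fun m : ℕ => tailTwos (b + 1) (n + m)) atTop (nhds 0) := by
    have h1 : Tendsto (fun m : ℕ => tailTwos (b + 1) m) atTop (nhds 0) := by
      refine squeeze_zero (fun m => tailTwos_nonneg _ _) (fun m => tailTwos_le b m) ?_
      refine Tendsto.div_atTop tendsto_const_nhds ?_
      exact tendsto_atTop_add_const_right _ _
        (tendsto_natCast_atTop_atTop.const_mul_atTop (by norm_num))
    simpa [add_comm] using (tendsto_add_atTop_iff_nat n).2 h1
  rw [hasSum_iff_tendsto_nat_of_nonneg
    (fun m => div_nonneg (tailTwos_nonneg _ _) (by positivity))]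
  have hsum (N : ℕ) : ∑ m ∈ range N, tailTwos b (n + m + 1) / ((n : ℝ) + m + 1) ^ 2
      = tailTwos (b + 1) n - tailTwos (b + 1) (n + N) := by
    induction N with
    | zero => simp
    | succ N ih =>
      rw [sum_range_succ, ih]
      have := tailTwos_sub b (n + N)
      push_cast at this
      rw [← this, add_assoc n N 1]
      ring
  simp only [hsum]
  simpa using hlim.const_sub (tailTwos (b + 1) n)

lemma tailTwos_zero_right (b : ℕ) :
    tailTwos b 0 = π ^ (2 * b) / (2 * b + 1).factorial := by
  have h := intervalIntegral.integral_eq_sub_of_hasDerivAt (a := 0) (b := π / 2)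
      (fun x _ => hasDerivAt_pi_sub_pow (2 * b) x) (Continuous.intervalIntegrable (by fun_prop) _ _)
  rw [intervalIntegral.integral_const_mul] at h
  have h0 : π - 2 * (π / 2) = 0 := by ring
  simp only [h0] at h
  simp at h
  simp only [tailTwos, sinPow_zero, mul_one]
  have : ∫ x in (0 : ℝ)..(π / 2), (π - 2 * x) ^ (2 * b) / (2 * b).factorial
      = π ^ (2 * b + 1) / (2 * b + 1).factorial / 2 := by
    rw [← h, intervalIntegral.integral_div]
    ring
  rw [this]
  field_simp
  ring

lemma tailTwos_succ_div (b n : ℕ) :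
    tailTwos b (n + 1) / ((n : ℝ) + 1) = 2 / π * ∫ x in (0 : ℝ)..(π / 2),
      (π - 2 * x) ^ (2 * b + 1) / (2 * b + 1).factorial *
        (wallisCoeff (n + 1) * (sin x ^ (2 * n + 1) * cos x)) := by
  have hG (x : ℝ) := (hasDerivAt_pi_sub_pow (2 * b) x).mul (hasDerivAt_sinPow n x)
  have h := intervalIntegral.integral_eq_sub_of_hasDerivAt (a := 0) (b := π / 2)
      (fun x _ => hG x) (Continuous.intervalIntegrable (by fun_prop) _ _)
  have h0 : π - 2 * (π / 2) = 0 := by ring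
  simp only [Pi.mul_apply, h0, sinPow, sin_zero] at h
  simp at h
  rw [div_eq_iff (by positivity)]
  have h1 : (∫ x in (0 : ℝ)..(π / 2), (-(2 * ((π - 2 * x) ^ (2 * b) / (2 * b).factorial) *
      (wallisCoeff (n + 1) * sin x ^ (2 * (n + 1)))) + (π - 2 * x) ^ (2 * b + 1) /
      (2 * b + 1).factorial * sinPowDeriv n x)) =
      ∫ x in (0 : ℝ)..(π / 2), ((-2) * ((π - 2 * x) ^ (2 * b) / (2 * b).factorial *
        sinPow (n + 1) x)
      + (2 * ((n : ℝ) + 1)) * ((π - 2 * x) ^ (2 * b + 1) / (2 * b + 1).factorial *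
        (wallisCoeff (n + 1) * (sin x ^ (2 * n + 1) * cos x)))) := by
    congr 1
    ext x
    simp only [sinPow, sinPowDeriv]
    ring
  rw [h1, intervalIntegral.integral_add (Continuous.intervalIntegrable (by fun_prop) _ _)
    (Continuous.intervalIntegrable (by fun_prop) _ _), intervalIntegral.integral_const_mul,
    intervalIntegral.integral_const_mul] at h
  simp only [tailTwos]
  linear_combination (-1 / π) * h

lemma headTwos_nonneg (a n : ℕ) : 0 ≤ headTwos a n := by
  induction a generalizing n with
  | zero => simp [headTwos]
  | succ a ih => exact sum_nonneg fun i _ => div_nonneg (ih i) (by positivity)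

lemma headTwos_le (a n : ℕ) : headTwos a n ≤ (n : ℝ) ^ a := by
  induction a generalizing n with
  | zero => simp [headTwos]
  | succ a ih =>
    calc headTwos (a + 1) n ≤ ∑ i ∈ range n, (n : ℝ) ^ a := by
          refine sum_le_sum fun i hi => ?_
          have hin : (i : ℝ) ≤ n := by exact_mod_cast (mem_range.1 hi).le
          calc headTwos a i / ((i : ℝ) + 1) ^ 2 ≤ headTwos a i :=
                div_le_self (headTwos_nonneg a i)
                  (one_le_pow₀ (by linarith [i.cast_nonneg (α := ℝ)]))
            _ ≤ (i : ℝ) ^ a := ih i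
            _ ≤ (n : ℝ) ^ a := by gcongr
      _ = _ := by simp [pow_succ, mul_comm]

lemma mem_Icc_of_hasDerivAt_mem_Icc {f f' : ℝ → ℝ} {M s : ℝ} (hf : ∀ x, HasDerivAt f (f' x) x)
    (hf0 : f 0 = 0) (h : ∀ u ∈ Set.Icc 0 s, f' u ∈ Set.Icc 0 M) :
    ∀ u ∈ Set.Icc 0 s, f u ∈ Set.Icc 0 (M * s) := by
  rintro u ⟨hu0, hus⟩
  have hM : 0 ≤ M := (h u ⟨hu0, hus⟩).1.trans (h u ⟨hu0, hus⟩).2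
  rcases hu0.eq_or_lt with rfl | hu
  · simp only [hf0, Set.mem_Icc, le_refl, true_and]
    positivity
  obtain ⟨c, hc, hcf⟩ := exists_hasDerivAt_eq_slope f f' hu
    (fun x _ => (hf x).continuousAt.continuousWithinAt) (fun x _ => hf x)
  obtain ⟨h1, h2⟩ := h c ⟨hc.1.le, hc.2.le.trans hus⟩
  rw [hf0, sub_zero, sub_zero, eq_div_iff hu.ne'] at hcf
  rw [← hcf]
  exact ⟨by positivity, by gcongr⟩

lemma sum_headTwos_mul_sub_zero (N : ℕ) (v : ℕ → ℝ) :
    ∑ n ∈ range N, headTwos 0 n * (v n - v (n + 1)) = v 0 - v N := by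
  simp only [headTwos, one_mul]
  exact sum_range_sub' v N

lemma sum_headTwos_mul_sub_succ (a N : ℕ) (v : ℕ → ℝ) :
    ∑ n ∈ range N, headTwos (a + 1) n * (v n - v (n + 1)) =
      ∑ n ∈ range N, headTwos a n / ((n : ℝ) + 1) ^ 2 * v (n + 1) - headTwos (a + 1) N * v N := by
  induction N with
  | zero => simp [headTwos]
  | succ N ih =>
    have : headTwos (a + 1) (N + 1) = headTwos (a + 1) N + headTwos a N / ((N : ℝ) + 1) ^ 2 := by
      simp only [headTwos, sum_range_succ]
    rw [sum_range_succ, ih, sum_range_succ, this]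
    ring

/-- The remainder in the expansion of `(2 * x) ^ (2 * a + 2) / (2 * a + 2)!` in powers of
`sin x ^ 2`. -/
noncomputable def sinPowRemainder (a N : ℕ) (x : ℝ) : ℝ :=
  (2 * x) ^ (2 * a + 2) / (2 * a + 2).factorial -
    ∑ n ∈ range N, headTwos a n / ((n : ℝ) + 1) ^ 2 * sinPow (n + 1) x

lemma hasDerivAt_two_mul_pow (k : ℕ) (x : ℝ) :
    HasDerivAt (fun x : ℝ => (2 * x) ^ (k + 1) / (k + 1).factorial)
      (2 * ((2 * x) ^ k / k.factorial)) x := by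
  have h := (((hasDerivAt_id x).const_mul 2).pow (k + 1)).div_const ((k + 1).factorial : ℝ)
  refine h.congr_deriv ?_
  have : (k.factorial : ℝ) ≠ 0 := by positivity
  rw [Nat.factorial_succ]
  push_cast
  field_simp
  simp

lemma sinPowRemainder_mem_Icc {a N : ℕ} {M s : ℝ}
    (h : ∀ u ∈ Set.Icc 0 s, 4 * ((2 * u) ^ (2 * a) / (2 * a).factorial) -
      4 * ∑ n ∈ range N, headTwos a n * (sinPow n u - sinPow (n + 1) u) ∈ Set.Icc 0 M) :
    ∀ u ∈ Set.Icc 0 s, sinPowRemainder a N u ∈ Set.Icc 0 (M * s * s) := by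
  refine mem_Icc_of_hasDerivAt_mem_Icc (f' := fun x => 2 * ((2 * x) ^ (2 * a + 1) /
    (2 * a + 1).factorial) - ∑ n ∈ range N, headTwos a n / ((n : ℝ) + 1) ^ 2 * sinPowDeriv n x)
    (fun x => ?_) ?_ (mem_Icc_of_hasDerivAt_mem_Icc (fun x => ?_) ?_ h)
  · exact (hasDerivAt_two_mul_pow (2 * a + 1) x).sub
      (HasDerivAt.fun_sum fun n _ => (hasDerivAt_sinPow n x).const_mul _)
  · simp [sinPowRemainder, sinPow]
  · refine (((hasDerivAt_two_mul_pow (2 * a) x).const_mul 2).sub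
      (HasDerivAt.fun_sum fun n _ => (hasDerivAt_sinPowDeriv n x).const_mul _)).congr_deriv ?_
    rw [mul_sum]
    congr 1
    · ring
    · refine sum_congr rfl fun n _ => ?_
      field_simp
  · simp [sinPowDeriv]

lemma tendsto_headTwos_mul_sinPow (a : ℕ) {s : ℝ} (hs0 : 0 ≤ s) (hs : s < π / 2) :
    Tendsto (fun N => headTwos a N * sinPow N s) atTop (nhds 0) := by
  have hq : |sin s ^ 2| < 1 := by
    have h1 : sin s < 1 := by
      rw [← sin_pi_div_two]
      exact sin_lt_sin_of_lt_of_le_pi_div_two (by linarith [pi_pos]) le_rfl hs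
    have h0 : 0 ≤ sin s := sin_nonneg_of_nonneg_of_le_pi hs0 (by linarith [pi_pos])
    rw [abs_of_nonneg (by positivity)]
    nlinarith
  have h1 := tendsto_pow_const_mul_const_pow_of_abs_lt_one (a + 1) hq
  have h2 := tendsto_pow_const_mul_const_pow_of_abs_lt_one a hq
  have h3 := (h1.const_mul 2).add h2
  simp only [mul_zero, add_zero] at h3
  refine squeeze_zero (fun N => mul_nonneg (headTwos_nonneg _ _) (sinPow_nonneg _ _))
    (fun N => ?_) h3
  calc headTwos a N * sinPow N s ≤ (N : ℝ) ^ a * ((2 * N + 1) * sin s ^ (2 * N)) := by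
        unfold sinPow
        have h2N : 0 ≤ sin s ^ (2 * N) := by rw [pow_mul]; positivity
        have := headTwos_le a N
        have := wallisCoeff_le N
        have := wallisCoeff_pos N
        gcongr
    _ = _ := by rw [pow_mul]; ring

lemma sinPow_le_sinPow (n : ℕ) {u s : ℝ} (hu : u ∈ Set.Icc 0 s) (hs : s ≤ π / 2) :
    sinPow n u ≤ sinPow n s := by
  have h0 : 0 ≤ sin u := sin_nonneg_of_nonneg_of_le_pi hu.1 (by linarith [hu.2, pi_pos])
  have := (wallisCoeff_pos n).le
  unfold sinPow
  gcongr
  exact sin_le_sin_of_le_of_le_pi_div_two (by linarith [hu.1, pi_pos]) hs hu.2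

lemma exists_tendsto_sinPowRemainder_mem_Icc (a : ℕ) {s : ℝ} (hs0 : 0 ≤ s) (hs : s < π / 2) :
    ∃ δ : ℕ → ℝ, Tendsto δ atTop (nhds 0) ∧
      ∀ N, ∀ u ∈ Set.Icc 0 s, sinPowRemainder a N u ∈ Set.Icc 0 (δ N) := by
  induction a with
  | zero =>
    refine ⟨fun N => 4 * (headTwos 0 N * sinPow N s) * s * s, ?_, fun N =>
      sinPowRemainder_mem_Icc fun u hu => ?_⟩
    · simpa using (((tendsto_headTwos_mul_sinPow 0 hs0 hs).const_mul 4).mul_const s).mul_const s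
    · rw [sum_headTwos_mul_sub_zero N (fun n => sinPow n u), sinPow_zero]
      have h1 := sinPow_le_sinPow N hu hs.le
      have h2 := sinPow_nonneg N u
      simp only [headTwos, Set.mem_Icc]
      constructor <;> simp <;> linarith
  | succ a ih =>
    obtain ⟨δ, hδ, h⟩ := ih
    refine ⟨fun N => (4 * (δ N + headTwos (a + 1) N * sinPow N s)) * s * s, ?_, fun N =>
      sinPowRemainder_mem_Icc fun u hu => ?_⟩
    · simpa using (((hδ.add (tendsto_headTwos_mul_sinPow (a + 1) hs0 hs)).const_mul 4).mul_const
        s).mul_const s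
    · rw [sum_headTwos_mul_sub_succ a N (fun n => sinPow n u)]
      obtain ⟨h1, h2⟩ := h N u hu
      have h3 := mul_le_mul_of_nonneg_left (sinPow_le_sinPow N hu hs.le)
        (headTwos_nonneg (a + 1) N)
      have h4 := mul_nonneg (headTwos_nonneg (a + 1) N) (sinPow_nonneg N u)
      simp only [sinPowRemainder] at h1 h2
      rw [show 2 * (a + 1) = 2 * a + 2 by ring]
      constructor <;> linarith

lemma hasSum_headTwos_mul_sinPow (a : ℕ) {s : ℝ} (hs0 : 0 ≤ s) (hs : s < π / 2) :
    HasSum (fun n : ℕ => headTwos a n / ((n : ℝ) + 1) ^ 2 * sinPow (n + 1) s)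
      ((2 * s) ^ (2 * a + 2) / (2 * a + 2).factorial) := by
  rw [hasSum_iff_tendsto_nat_of_nonneg fun n => mul_nonneg
    (div_nonneg (headTwos_nonneg a n) (by positivity)) (sinPow_nonneg _ _)]
  obtain ⟨δ, hδ, h⟩ := exists_tendsto_sinPowRemainder_mem_Icc a hs0 hs
  have h0 : Tendsto (fun N => sinPowRemainder a N s) atTop (nhds 0) :=
    squeeze_zero (fun N => (h N s ⟨hs0, le_rfl⟩).1) (fun N => (h N s ⟨hs0, le_rfl⟩).2) hδ
  have := h0.const_sub ((2 * s) ^ (2 * a + 2) / (2 * a + 2).factorial)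
  simpa [sinPowRemainder] using this

lemma sinc_pos_of_mem_Icc {x : ℝ} (hx : x ∈ Set.Icc 0 (π / 2)) : 0 < sinc x := by
  rcases hx.1.eq_or_lt with rfl | h
  · simp
  · rw [sinc_of_ne_zero h.ne']
    exact div_pos (sin_pos_of_pos_of_lt_pi h (by linarith [hx.2, pi_pos])) h

/-- The polynomial weight `(2 * x) ^ i / i! * (π - 2 * x) ^ j / j!`. -/
noncomputable def betaWeight (i j : ℕ) (x : ℝ) : ℝ :=
  (2 * x) ^ i / i.factorial * ((π - 2 * x) ^ j / j.factorial)

/-- The continuous extension of `betaWeight (i + 1) j x / sin x` to `x = 0`. -/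
noncomputable def betaWeightDivSin (i j : ℕ) (x : ℝ) : ℝ :=
  2 * (2 * x) ^ i / (i + 1).factorial * ((π - 2 * x) ^ j / j.factorial) / sinc x

@[fun_prop]
lemma continuous_betaWeight (i j : ℕ) : Continuous (betaWeight i j) := by
  unfold betaWeight; fun_prop

lemma continuousOn_betaWeightDivSin (i j : ℕ) :
    ContinuousOn (betaWeightDivSin i j) (Set.uIcc 0 (π / 2)) := by
  rw [Set.uIcc_of_le (by positivity)]
  unfold betaWeightDivSin
  exact ContinuousOn.div (by fun_prop) continuous_sinc.continuousOn
    fun x hx => (sinc_pos_of_mem_Icc hx).ne'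

lemma betaWeightDivSin_mul_sin (i j : ℕ) {x : ℝ} (hx : x ∈ Set.Icc 0 (π / 2)) :
    betaWeightDivSin i j x * sin x = betaWeight (i + 1) j x := by
  rw [betaWeightDivSin, div_mul_eq_mul_div, div_eq_iff (sinc_pos_of_mem_Icc hx).ne', betaWeight]
  rcases eq_or_ne x 0 with rfl | h
  · simp
  · rw [sinc_of_ne_zero h]
    field_simp
    ring

lemma hasSum_headTwos_mul_tailTwos (a b : ℕ) :
    HasSum (fun n : ℕ => headTwos a n * tailTwos b (n + 1) / ((n : ℝ) + 1) ^ 3)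
      (2 / π * ∫ x in (0 : ℝ)..(π / 2),
        betaWeightDivSin (2 * a + 1) (2 * b + 1) x * cos x) := by
  set F : ℕ → ℝ → ℝ := fun n x => headTwos a n / ((n : ℝ) + 1) ^ 2 *
    ((π - 2 * x) ^ (2 * b + 1) / (2 * b + 1).factorial *
        (wallisCoeff (n + 1) * (sin x ^ (2 * n + 1) * cos x))) with hF
  have hmem {x : ℝ} (hx : x ∈ Set.uIoc 0 (π / 2)) : 0 < x ∧ x ≤ π / 2 := by
    rwa [Set.uIoc_of_le (by positivity)] at hx
  have hpos (n : ℕ) (x : ℝ) (hx : x ∈ Set.uIoc 0 (π / 2)) : 0 ≤ F n x := by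
    obtain ⟨h0, h1⟩ := hmem hx
    have h2 : 0 ≤ sin x := sin_nonneg_of_nonneg_of_le_pi h0.le (by linarith)
    have h3 : 0 ≤ cos x := cos_nonneg_of_mem_Icc ⟨by linarith, h1⟩
    have h4 : 0 ≤ π - 2 * x := by linarith
    have h5 := headTwos_nonneg a n
    have h6 := wallisCoeff_pos (n + 1)
    simp only [hF]
    positivity
  have hsum (x : ℝ) (hx : x ∈ Set.uIoc 0 (π / 2)) :
      HasSum (fun n => F n x) (betaWeightDivSin (2 * a + 1) (2 * b + 1) x * cos x) := by
    obtain ⟨h0, h1⟩ := hmem hx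
    rcases h1.eq_or_lt with rfl | h1
    · simp [hF, hasSum_zero]
    have hs : 0 < sin x := sin_pos_of_pos_of_lt_pi h0 (by linarith)
    have h := (hasSum_headTwos_mul_sinPow a h0.le h1).mul_right
      ((π - 2 * x) ^ (2 * b + 1) / (2 * b + 1).factorial * (cos x / sin x))
    have hval := betaWeightDivSin_mul_sin (2 * a + 1) (2 * b + 1) (x := x) ⟨h0.le, h1.le⟩
    rw [← eq_div_iff hs.ne'] at hval
    rw [hval, betaWeight, div_mul_eq_mul_div, mul_div_assoc, mul_assoc]
    suffices hFn : ∀ n : ℕ, F n x = headTwos a n / ((n : ℝ) + 1) ^ 2 * sinPow (n + 1) x *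
        ((π - 2 * x) ^ (2 * b + 1) / (2 * b + 1).factorial * (cos x / sin x)) by
      simpa only [hFn] using h
    intro n
    simp only [hF, sinPow]
    field_simp
    ring
  have hintegral := intervalIntegral.hasSum_integral_of_dominated_convergence
    (μ := MeasureTheory.volume) (a := 0) (b := π / 2) (F := F)
    (f := fun x => betaWeightDivSin (2 * a + 1) (2 * b + 1) x * cos x) F
    (fun n => Continuous.aestronglyMeasurable (by simp only [hF]; fun_prop))
    (fun n => Filter.Eventually.of_forall fun x hx => by
      rw [Real.norm_of_nonneg (hpos n x hx)])
    (Filter.Eventually.of_forall fun x hx => (hsum x hx).summable)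
    ?_ (Filter.Eventually.of_forall hsum)
  · suffices h : ∀ n : ℕ, headTwos a n * tailTwos b (n + 1) / ((n : ℝ) + 1) ^ 3
        = 2 / π * ∫ x in (0 : ℝ)..(π / 2), F n x by
      simpa only [h] using hintegral.mul_left (2 / π)
    intro n
    simp only [hF]
    rw [intervalIntegral.integral_const_mul, mul_left_comm, ← tailTwos_succ_div]
    field_simp
  · refine IntervalIntegrable.congr
      (f := fun x => betaWeightDivSin (2 * a + 1) (2 * b + 1) x * cos x)
      (fun x hx => (hsum x hx).tsum_eq.symm) (ContinuousOn.intervalIntegrable ?_)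
    exact (continuousOn_betaWeightDivSin _ _).mul (by fun_prop)

lemma tendsto_intervalIntegral_mul_cos {f : ℝ → ℝ} {a b : ℝ} (hab : a ≤ b)
    (hf : IntervalIntegrable f MeasureTheory.volume a b) :
    Tendsto (fun w : ℝ => ∫ x in a..b, f x * cos (w * x)) atTop (nhds 0) := by
  have h := Real.tendsto_integral_exp_smul_cocompact
    ((Set.Ioc a b).indicator fun x => (f x : ℂ))
  have hw : Tendsto (fun w : ℝ => w / (2 * π)) atTop (cocompact ℝ) :=
    (tendsto_id.atTop_div_const (by positivity)).mono_right atTop_le_cocompact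
  have h2 := (Complex.continuous_re.tendsto 0).comp (h.comp hw)
  simp only [Complex.zero_re] at h2
  refine h2.congr fun w => ?_
  have hfc : MeasureTheory.Integrable ((Set.Ioc a b).indicator fun x => (f x : ℂ)) :=
    (MeasureTheory.integrable_indicator_iff measurableSet_Ioc).2
      ((intervalIntegrable_iff_integrableOn_Ioc_of_le hab).1 hf).ofReal
  have hintegral : MeasureTheory.Integrable (fun v : ℝ => Real.fourierChar (-(v * (w / (2 * π)))) •
      (Set.Ioc a b).indicator (fun x => (f x : ℂ)) v) := by
    simpa only [RCLike.inner_apply, conj_trivial, mul_comm] using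
      (Real.fourierIntegral_convergent_iff (w / (2 * π))).2 hfc
  simp only [Function.comp_apply]
  rw [← RCLike.re_eq_complex_re, ← integral_re hintegral, intervalIntegral.integral_of_le hab,
    ← MeasureTheory.integral_indicator measurableSet_Ioc]
  congr 1
  ext v
  by_cases hv : v ∈ Set.Ioc a b
  · simp only [hv, Set.indicator_of_mem]
    rw [Circle.smul_def, Real.fourierChar_apply]
    have hphase : 2 * π * -(v * (w / (2 * π))) = -(w * v) := by field_simp
    rw [hphase, smul_eq_mul, RCLike.re_eq_complex_re, Complex.re_mul_ofReal,
      Complex.exp_ofReal_mul_I_re, cos_neg, mul_comm]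
  · simp [hv]

lemma cos_eq_sum_add (N : ℕ) (x : ℝ) :
    cos x = sin x * ∑ n ∈ range N, 2 * sin (2 * ((n : ℝ) + 1) * x) + cos ((2 * N + 1) * x) := by
  induction N with
  | zero => simp
  | succ N ih =>
    rw [sum_range_succ, mul_add]
    push_cast
    have h1 : cos ((2 * (N : ℝ) + 1) * x) = cos (2 * ((N : ℝ) + 1) * x - x) := by ring_nf
    have h2 : cos ((2 * ((N : ℝ) + 1) + 1) * x) = cos (2 * ((N : ℝ) + 1) * x + x) := by ring_nf
    rw [h1, cos_sub] at ih
    rw [h2, cos_add]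
    linear_combination ih

lemma tendsto_sum_integral_betaWeight_mul_sin (i j : ℕ) :
    Tendsto (fun N : ℕ => ∑ n ∈ range N, 2 * ∫ x in (0 : ℝ)..(π / 2),
        betaWeight (i + 1) j x * sin (2 * ((n : ℝ) + 1) * x)) atTop
      (nhds (∫ x in (0 : ℝ)..(π / 2), betaWeightDivSin i j x * cos x)) := by
  have hq := (continuousOn_betaWeightDivSin i j).intervalIntegrable
    (μ := MeasureTheory.volume)
  have hw : Tendsto (fun N : ℕ => 2 * (N : ℝ) + 1) atTop atTop :=
    tendsto_atTop_add_const_right _ _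
      (tendsto_natCast_atTop_atTop.const_mul_atTop (by norm_num))
  have h := ((tendsto_intervalIntegral_mul_cos (by positivity) hq).comp hw).const_sub
    (∫ x in (0 : ℝ)..(π / 2), betaWeightDivSin i j x * cos x)
  rw [sub_zero] at h
  refine h.congr fun N => ?_
  simp only [Function.comp_apply]
  rw [← intervalIntegral.integral_sub (hq.mul_continuousOn (by fun_prop))
    (hq.mul_continuousOn (by fun_prop))]
  simp only [← intervalIntegral.integral_const_mul]
  rw [← intervalIntegral.integral_finsetSum
    fun n _ => Continuous.intervalIntegrable (by fun_prop) _ _]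
  refine intervalIntegral.integral_congr fun x hx => ?_
  rw [Set.uIcc_of_le (by positivity)] at hx
  rw [← betaWeightDivSin_mul_sin i j hx]
  have hsum : ∑ n ∈ range N, 2 * (betaWeightDivSin i j x * sin x * sin (2 * ((n : ℝ) + 1) * x)) =
      betaWeightDivSin i j x * (sin x * ∑ n ∈ range N, 2 * sin (2 * ((n : ℝ) + 1) * x)) := by
    rw [← mul_assoc, mul_sum]
    exact sum_congr rfl fun n _ => by ring
  rw [hsum]
  linear_combination betaWeightDivSin i j x * cos_eq_sum_add N x

open Polynomial in
lemma integral_polynomial_mul_sin (m : ℕ) (hm : m ≠ 0) (K : ℕ) (p : ℝ[X])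
    (hp : p.natDegree < 2 * K) :
    2 * ∫ x in (0 : ℝ)..(π / 2), p.eval (2 * x) * sin (2 * m * x) =
      ∑ j ∈ range K, (-1) ^ j * (((derivative^[2 * j] p).eval 0
        - (-1) ^ m * (derivative^[2 * j] p).eval π) / (m : ℝ) ^ (2 * j + 1)) := by
  have hm' : (m : ℝ) ≠ 0 := by exact_mod_cast hm
  induction K generalizing p with
  | zero => simp at hp
  | succ K ih =>
    have hG (x : ℝ) : HasDerivAt (fun x => (derivative p).eval (2 * x) * sin (2 * m * x) /
          (2 * m ^ 2) - p.eval (2 * x) * cos (2 * m * x) / (2 * m))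
        (p.eval (2 * x) * sin (2 * m * x) +
          (derivative (derivative p)).eval (2 * x) * sin (2 * m * x) / m ^ 2) x := by
      have h2 : HasDerivAt (fun x : ℝ => 2 * x) 2 x := by
        simpa using (hasDerivAt_id x).const_mul 2
      have h2m : HasDerivAt (fun x : ℝ => 2 * m * x) (2 * m) x := by
        simpa using (hasDerivAt_id x).const_mul (2 * (m : ℝ))
      have hev (q : ℝ[X]) : HasDerivAt (fun x => q.eval (2 * x))
          ((derivative q).eval (2 * x) * 2) x := (q.hasDerivAt (2 * x)).comp x h2
      refine ((((hev _).mul h2m.sin).div_const _).sub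
        (((hev p).mul h2m.cos).div_const _)).congr_deriv ?_
      field_simp
      ring
    have h := intervalIntegral.integral_eq_sub_of_hasDerivAt (a := 0) (b := π / 2)
      (fun x _ => hG x) (Continuous.intervalIntegrable (by fun_prop) _ _)
    rw [intervalIntegral.integral_add (Continuous.intervalIntegrable (by fun_prop) _ _)
      (Continuous.intervalIntegrable (by fun_prop) _ _), intervalIntegral.integral_div] at h
    have hcos : cos (2 * m * (π / 2)) = (-1) ^ m := by
      rw [← cos_nat_mul_pi]; ring_nf
    have hsin : sin (2 * m * (π / 2)) = 0 := by
      rw [← sin_nat_mul_pi m]; ring_nf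
    rw [hcos, hsin, mul_div_cancel₀ π two_ne_zero] at h
    simp only [mul_zero, sin_zero, cos_zero, zero_div, mul_one] at h
    have hI := eq_sub_of_add_eq h
    rw [hI, mul_sub, mul_div_assoc', sum_range_succ']
    rcases Nat.eq_zero_or_pos K with rfl | hK
    · have hd : derivative (derivative p) = 0 := by
        have := Polynomial.iterate_derivative_eq_zero (p := p) (x := 2) (by lia)
        simpa using this
      simp [hd]
      field_simp
      ring
    · rw [ih (derivative (derivative p)) (by
        have h1 := natDegree_derivative_le p
        have h2 := natDegree_derivative_le (derivative p)
        lia)]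
      have hshift (j : ℕ) : derivative^[2 * j] (derivative (derivative p))
          = derivative^[2 * (j + 1)] p := by
        rw [mul_add, Function.iterate_add_apply]
        rfl
      simp only [hshift, sum_div]
      rw [sub_eq_add_neg, add_comm, ← sum_neg_distrib]
      congr 1
      · refine sum_congr rfl fun j _ => ?_
        field_simp
        ring
      · simp
        field_simp
        ring

open Polynomial in
lemma eval_iterate_derivative_eq_coeff_taylor (p : ℝ[X]) (k : ℕ) (r : ℝ) :
    (derivative^[k] p).eval r = k.factorial * (taylor r p).coeff k := by
  rw [taylor_coeff, ← factorial_smul_hasseDeriv]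
  simp

/-- The polynomial with `betaWeight i j x = (betaPolynomial i j).eval (2 * x)`. -/
noncomputable def betaPolynomial (i j : ℕ) : Polynomial ℝ :=
  Polynomial.C ((-1 : ℝ) ^ j / (i.factorial * j.factorial)) *
    (Polynomial.X ^ i * (Polynomial.X - Polynomial.C π) ^ j)

lemma eval_betaPolynomial (i j : ℕ) (x : ℝ) :
    (betaPolynomial i j).eval (2 * x) = betaWeight i j x := by
  have : (π - 2 * x) ^ j = (-1) ^ j * (2 * x - π) ^ j := by rw [← mul_pow]; ring
  simp only [betaPolynomial, betaWeight, this]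
  simp
  field_simp

lemma natDegree_betaPolynomial_le (i j : ℕ) : (betaPolynomial i j).natDegree ≤ i + j := by
  unfold betaPolynomial
  compute_degree

lemma choose_div_factorial_eq {i j k : ℕ} (hi : i ≤ k) (hk : k ≤ i + j) :
    (k.factorial : ℝ) / (i.factorial * j.factorial) * (j.choose (k - i)) =
      k.choose i / (i + j - k).factorial := by
  rw [Nat.cast_choose ℝ hi, Nat.cast_choose ℝ (show k - i ≤ j by lia),
    show j - (k - i) = i + j - k by lia]
  field_simp

open Polynomial in
lemma eval_zero_iterate_derivative_betaPolynomial {i j k : ℕ} (hk : k ≤ i + j)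
    (heven : Even (i + k)) :
    (derivative^[k] (betaPolynomial i j)).eval 0 =
      k.choose i * (π ^ (i + j - k) / (i + j - k).factorial) := by
  rw [eval_iterate_derivative_eq_coeff_taylor, taylor_zero, betaPolynomial, coeff_C_mul,
    coeff_X_pow_mul']
  split_ifs with hi
  · rw [sub_eq_add_neg, ← C_neg, coeff_X_add_C_pow, show j - (k - i) = i + j - k by lia]
    have hsign : (-1 : ℝ) ^ j * (-π) ^ (i + j - k) = π ^ (i + j - k) := by
      rw [neg_pow π, ← mul_assoc, ← pow_add, Even.neg_one_pow, one_mul]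
      obtain ⟨c, hc⟩ := heven
      exact ⟨j + c - k, by lia⟩
    have := choose_div_factorial_eq hi hk
    linear_combination (k.factorial : ℝ) / (i.factorial * j.factorial) *
      (j.choose (k - i)) * hsign + π ^ (i + j - k) * this
  · simp [Nat.choose_eq_zero_of_lt (not_le.1 hi)]

open Polynomial in
lemma eval_pi_iterate_derivative_betaPolynomial {i j k : ℕ} (hk : k ≤ i + j) :
    (derivative^[k] (betaPolynomial i j)).eval π =
      (-1) ^ j * (k.choose j * (π ^ (i + j - k) / (i + j - k).factorial)) := by
  have htaylor : taylor π (betaPolynomial i j) =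
      C ((-1 : ℝ) ^ j / (i.factorial * j.factorial)) * (X ^ j * (X + C π) ^ i) := by
    simp [betaPolynomial, mul_comm]
  rw [eval_iterate_derivative_eq_coeff_taylor, htaylor, coeff_C_mul, coeff_X_pow_mul']
  split_ifs with hj
  · rw [coeff_X_add_C_pow, show i - (k - j) = i + j - k by lia]
    have := choose_div_factorial_eq (j := i) hj (by lia)
    rw [add_comm j i] at this
    linear_combination (-1) ^ j * π ^ (i + j - k) * this
  · simp [Nat.choose_eq_zero_of_lt (not_le.1 hj)]

lemma tendsto_sum_zeta {k : ℕ} (hk : 2 ≤ k) :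
    Tendsto (fun N => ∑ m ∈ range N, 1 / ((m + 1 : ℝ)) ^ k) atTop (nhds (zeta k)) := by
  rw [zeta, if_neg (by lia)]
  have hs : Summable fun m : ℕ => 1 / ((m : ℝ) + 1) ^ k := by
    simpa using (summable_nat_add_iff 1).2 (Real.summable_one_div_nat_pow.2 (by lia : 1 < k))
  exact tendsto_nhds_limUnder ⟨_, hs.hasSum.tendsto_sum_nat⟩

lemma tendsto_sum_zetaA {k : ℕ} (hk : 2 ≤ k) :
    Tendsto (fun N => ∑ m ∈ range N, (-1 : ℝ) ^ (m + 1) / ((m + 1 : ℝ)) ^ k) atTop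
      (nhds (zetaA k)) := by
  rw [zetaA, if_neg (by lia)]
  have hs : Summable fun m : ℕ => 1 / ((m : ℝ) + 1) ^ k := by
    simpa using (summable_nat_add_iff 1).2 (Real.summable_one_div_nat_pow.2 (by lia : 1 < k))
  have hs' : Summable fun m : ℕ => (-1 : ℝ) ^ (m + 1) / ((m : ℝ) + 1) ^ k := by
    refine Summable.of_norm_bounded hs fun m => le_of_eq ?_
    rw [norm_div, norm_pow, norm_neg, norm_one, one_pow, Real.norm_of_nonneg (by positivity)]
  exact tendsto_nhds_limUnder ⟨_, hs'.hasSum.tendsto_sum_nat⟩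

lemma two_mul_integral_betaWeight_mul_sin (a b n : ℕ) :
    2 * ∫ x in (0 : ℝ)..(π / 2),
        betaWeight (2 * a + 2) (2 * b + 1) x * sin (2 * ((n : ℝ) + 1) * x) =
      ∑ r ∈ Icc 1 (a + b + 1), (-1) ^ r * (π ^ (2 * (a + b + 1 - r) + 1) /
        (2 * (a + b + 1 - r) + 1).factorial) *
        ((2 * r).choose (2 * a + 2) * (1 / ((n : ℝ) + 1) ^ (2 * r + 1)) +
          (2 * r).choose (2 * b + 1) * ((-1) ^ (n + 1) / ((n : ℝ) + 1) ^ (2 * r + 1))) := by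
  have h := integral_polynomial_mul_sin (n + 1) n.succ_ne_zero (a + b + 1 + 1)
    (betaPolynomial (2 * a + 2) (2 * b + 1))
    ((natDegree_betaPolynomial_le _ _).trans_lt (by lia))
  simp only [eval_betaPolynomial] at h
  push_cast at h
  rw [h, range_eq_Ico, sum_eq_sum_Ico_succ_bot (by lia),
    eval_zero_iterate_derivative_betaPolynomial (by lia) ⟨a + 1, by lia⟩,
    eval_pi_iterate_derivative_betaPolynomial (by lia)]
  simp only [mul_zero, Nat.choose_eq_zero_of_lt (show 0 < 2 * a + 2 by lia),
    Nat.choose_eq_zero_of_lt (show 0 < 2 * b + 1 by lia), Nat.cast_zero, zero_mul, sub_zero,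
    zero_div, zero_add]
  refine sum_congr rfl fun r hr => ?_
  replace hr := mem_Icc.1 hr
  rw [eval_zero_iterate_derivative_betaPolynomial (by lia) ⟨a + 1 + r, by lia⟩,
    eval_pi_iterate_derivative_betaPolynomial (by lia),
    show 2 * a + 2 + (2 * b + 1) - 2 * r = 2 * (a + b + 1 - r) + 1 by lia,
    Odd.neg_one_pow ⟨b, rfl⟩]
  field_simp
  ring

lemma integral_betaWeightDivSin_mul_cos (a b : ℕ) :
    ∫ x in (0 : ℝ)..(π / 2), betaWeightDivSin (2 * a + 1) (2 * b + 1) x * cos x =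
      ∑ r ∈ Icc 1 (a + b + 1), (-1) ^ r * (π ^ (2 * (a + b + 1 - r) + 1) /
        (2 * (a + b + 1 - r) + 1).factorial) *
        ((2 * r).choose (2 * a + 2) * zeta (2 * r + 1) +
          (2 * r).choose (2 * b + 1) * zetaA (2 * r + 1)) := by
  refine tendsto_nhds_unique (tendsto_sum_integral_betaWeight_mul_sin (2 * a + 1) (2 * b + 1)) ?_
  simp only [two_mul_integral_betaWeight_mul_sin]
  have h : Tendsto (fun N : ℕ => ∑ r ∈ Icc 1 (a + b + 1), (-1 : ℝ) ^ r *
      (π ^ (2 * (a + b + 1 - r) + 1) / (2 * (a + b + 1 - r) + 1).factorial) *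
        ((2 * r).choose (2 * a + 2) * ∑ n ∈ range N, 1 / ((n + 1 : ℝ)) ^ (2 * r + 1) +
          (2 * r).choose (2 * b + 1) *
            ∑ n ∈ range N, (-1 : ℝ) ^ (n + 1) / ((n + 1 : ℝ)) ^ (2 * r + 1))) atTop _ :=
    tendsto_finsetSum _ fun r hr => by
      rw [mem_Icc] at hr
      exact (((tendsto_sum_zeta (by lia)).const_mul _).add
        ((tendsto_sum_zetaA (by lia)).const_mul _)).const_mul _
  refine h.congr fun N => ?_
  rw [sum_comm]
  refine sum_congr rfl fun r _ => ?_
  rw [mul_sum, mul_sum, ← sum_add_distrib, mul_sum]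

open scoped ENNReal

/-- `∑_{N < m₁ < … < m_n} ∏ 1 / m_i ^ k_i` as an extended nonnegative real. -/
noncomputable def mzvTail {n : ℕ} (k : Fin n → ℕ) (N : ℕ) : ℝ≥0∞ :=
  ∑' f : {f : Fin n → ℕ+ // StrictMono f ∧ ∀ i, N < f i}, ∏ i, ((f.1 i : ℝ≥0∞) ^ k i)⁻¹

lemma mzv_eq_toReal_mzvTail (n : ℕ) (k : Fin n → ℕ) : mzv n k = (mzvTail k 0).toReal := by
  have hne (m : ℕ+) (j : ℕ) : ((m : ℝ≥0∞) ^ j)⁻¹ ≠ ∞ :=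
    ENNReal.inv_ne_top.2 (pow_ne_zero _ (by exact_mod_cast m.ne_zero))
  rw [mzvTail, ENNReal.tsum_toReal_eq fun f => ENNReal.prod_ne_top fun i _ => hne _ _, mzv]
  let e : {f : Fin n → ℕ+ // StrictMono f} ≃
      {f : Fin n → ℕ+ // StrictMono f ∧ ∀ i, 0 < (f i : ℕ)} :=
    Equiv.subtypeEquivRight fun f => by simp
  rw [← e.tsum_eq]
  refine tsum_congr fun f => ?_
  simp [e, ENNReal.toReal_prod]

/-- Splitting off the smallest entry of a strictly increasing sequence. -/
def strictMonoConsEquiv (n N : ℕ) :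
    {f : Fin (n + 1) → ℕ+ // StrictMono f ∧ ∀ i, N < f i} ≃
      Σ m : {m : ℕ+ // N < m}, {g : Fin n → ℕ+ // StrictMono g ∧ ∀ i, (m.1 : ℕ) < g i} where
  toFun f := ⟨⟨f.1 0, f.2.2 0⟩, ⟨Fin.tail f.1, fun i j h => f.2.1 (Fin.succ_lt_succ_iff.2 h),
    fun i => f.2.1 (Fin.succ_pos i)⟩⟩
  invFun p := ⟨Fin.cons p.1.1 p.2.1, by
    refine ⟨fun i j hij => ?_, fun i => ?_⟩
    · induction j using Fin.cases with
      | zero => exact absurd hij (Fin.not_lt_zero i)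
      | succ j =>
        induction i using Fin.cases with
        | zero => simpa using p.2.2.2 j
        | succ i => simpa using p.2.2.1 (Fin.succ_lt_succ_iff.1 hij)
    · induction i using Fin.cases with
      | zero => simpa using p.1.2
      | succ i => simpa using p.1.2.trans (p.2.2.2 i)⟩
  left_inv f := by simp
  right_inv _ := rfl

lemma tsum_pnat_subtype_eq (N : ℕ) (F : ℕ → ℝ≥0∞) :
    ∑' m : {m : ℕ+ // N < m}, F (m.1 : ℕ) = ∑' m : ℕ, F (N + m + 1) := by
  let e : ℕ ≃ {m : ℕ+ // N < m} :=
    { toFun := fun m => ⟨⟨N + m + 1, by lia⟩, by simp only [PNat.mk_coe]; lia⟩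
      invFun := fun m => m.1 - (N + 1)
      left_inv := fun m => by simp only [PNat.mk_coe]; lia
      right_inv := fun m => by
        have := m.2
        apply Subtype.ext
        apply PNat.eq
        simp
        lia }
  rw [← e.tsum_eq]
  rfl

lemma mzvTail_succ {n : ℕ} (k : Fin (n + 1) → ℕ) (N : ℕ) :
    mzvTail k N = ∑' m : ℕ,
      (((N + m + 1 : ℕ) : ℝ≥0∞) ^ k 0)⁻¹ * mzvTail (Fin.tail k) (N + m + 1) := by
  rw [mzvTail, ← (strictMonoConsEquiv n N).symm.tsum_eq, ENNReal.tsum_sigma',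
    ← tsum_pnat_subtype_eq N fun m => ((m : ℝ≥0∞) ^ k 0)⁻¹ * mzvTail (Fin.tail k) m]
  refine tsum_congr fun m => ?_
  rw [mzvTail, ← ENNReal.tsum_mul_left]
  refine tsum_congr fun g => ?_
  exact Fin.prod_univ_succ _

lemma mzvTail_zero (k : Fin 0 → ℕ) (N : ℕ) : mzvTail k N = 1 := by
  rw [mzvTail]
  have : Unique {f : Fin 0 → ℕ+ // StrictMono f ∧ ∀ i, N < f i} :=
    { default := ⟨Fin.elim0, fun i => i.elim0, fun i => i.elim0⟩
      uniq := fun f => Subtype.ext (funext fun i => i.elim0) }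
  simp

lemma inv_pow_natCast_succ (n k : ℕ) :
    (((n + 1 : ℕ) : ℝ≥0∞) ^ k)⁻¹ = ENNReal.ofReal (1 / ((n : ℝ) + 1) ^ k) := by
  rw [one_div, ENNReal.ofReal_inv_of_pos (by positivity), ENNReal.ofReal_pow (by positivity),
    ← ENNReal.ofReal_natCast, Nat.cast_succ]

lemma mzvTail_twos (b N : ℕ) : mzvTail (fun _ : Fin b => 2) N = ENNReal.ofReal (tailTwos b N) := by
  induction b generalizing N with
  | zero => rw [mzvTail_zero, tailTwos_zero_left, ENNReal.ofReal_one]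
  | succ b ih =>
    rw [mzvTail_succ, ← (hasSum_tailTwos b N).tsum_eq, ENNReal.ofReal_tsum_of_nonneg
      (fun m => div_nonneg (tailTwos_nonneg _ _) (by positivity)) (hasSum_tailTwos b N).summable]
    refine tsum_congr fun m => ?_
    have ih' : mzvTail (Fin.tail fun _ : Fin (b + 1) => 2) (N + m + 1) = _ := ih (N + m + 1)
    rw [ih', inv_pow_natCast_succ, ← ENNReal.ofReal_mul (by positivity), one_div_mul_eq_div,
      Nat.cast_add]

/-- The sum `∑_{N < m₁ < … < m_a < m} ∏ 1 / m_i ^ 2`, zero unless `N < m`. -/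
noncomputable def midTwos : ℕ → ℕ → ℕ → ℝ≥0∞
  | 0, N, m => if N < m then 1 else 0
  | a + 1, N, m => ∑' l : ℕ, if N < l then ((l : ℝ≥0∞) ^ 2)⁻¹ * midTwos a l m else 0

lemma midTwos_succ (a N m : ℕ) :
    midTwos (a + 1) N m = ∑' l : ℕ, if l < m then ((l : ℝ≥0∞) ^ 2)⁻¹ * midTwos a N l else 0 := by
  induction a generalizing N with
  | zero =>
    simp only [midTwos]
    refine tsum_congr fun l => ?_
    split_ifs <;> simp
  | succ a ih =>
    have hl : midTwos (a + 1 + 1) N m = ∑' l : ℕ, ∑' l' : ℕ, if N < l ∧ l' < m then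
        ((l : ℝ≥0∞) ^ 2)⁻¹ * (((l' : ℝ≥0∞) ^ 2)⁻¹ * midTwos a l l') else 0 := by
      rw [midTwos]
      refine tsum_congr fun l => ?_
      split_ifs with h
      · rw [ih, ← ENNReal.tsum_mul_left]
        refine tsum_congr fun l' => ?_
        simp [h]
      · simp [h]
    rw [hl, ENNReal.tsum_comm]
    refine tsum_congr fun l' => ?_
    split_ifs with h
    · rw [midTwos, ← ENNReal.tsum_mul_left]
      refine tsum_congr fun l => ?_
      split_ifs <;> simp_all [mul_left_comm]
    · simp [h]

lemma midTwos_self_zero (a N : ℕ) : midTwos a N 0 = 0 := by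
  cases a with
  | zero => simp [midTwos]
  | succ a => simp [midTwos_succ]

lemma midTwos_zero_eq (a m : ℕ) : midTwos a 0 (m + 1) = ENNReal.ofReal (headTwos a m) := by
  induction a generalizing m with
  | zero => simp [midTwos, headTwos]
  | succ a ih =>
    rw [midTwos_succ, headTwos, ENNReal.ofReal_sum_of_nonneg
      fun i _ => div_nonneg (headTwos_nonneg a i) (by positivity),
      tsum_eq_zero_add' ENNReal.summable, tsum_eq_sum (s := range m) (by simp; grind)]
    simp only [midTwos_self_zero, mul_zero, ite_self, zero_add]
    refine sum_congr rfl fun i hi => ?_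
    rw [mem_range] at hi
    rw [if_pos (by lia), ih, inv_pow_natCast_succ, ← ENNReal.ofReal_mul (by positivity),
      one_div_mul_eq_div]

lemma tsum_nat_add_eq (N : ℕ) (F : ℕ → ℝ≥0∞) :
    ∑' m : ℕ, F (N + m + 1) = ∑' m : ℕ, if N < m then F m else 0 := by
  have hinj : Function.Injective fun m : ℕ => N + m + 1 := fun m m' h => by simpa using h
  rw [← hinj.tsum_eq (f := fun m => if N < m then F m else 0)]
  · exact tsum_congr fun m => (if_pos (by lia)).symm
  · intro m hm
    have hm' : N < m := by
      by_contra h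
      simp [h] at hm
    exact ⟨m - (N + 1), by simp only; lia⟩

lemma mzvTail_congr {n n' : ℕ} (h : n = n') {k : Fin n → ℕ} {k' : Fin n' → ℕ}
    (hk : ∀ i : Fin n, k i = k' (Fin.cast h i)) (N : ℕ) : mzvTail k N = mzvTail k' N := by
  subst h
  congr 1
  exact funext hk

lemma mzvTail_expo232 (a b N : ℕ) : mzvTail (expo232 a b) N =
    ∑' m : ℕ, midTwos a N m * (((m : ℝ≥0∞) ^ 3)⁻¹ * ENNReal.ofReal (tailTwos b m)) := by
  induction a generalizing N with
  | zero =>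
    have htail (m : ℕ) : mzvTail (Fin.tail (expo232 0 b)) m = ENNReal.ofReal (tailTwos b m) := by
      rw [← mzvTail_twos]
      exact mzvTail_congr (by lia) (fun i => by simp [expo232, Fin.tail]) m
    rw [mzvTail_succ, tsum_nat_add_eq N fun m =>
      ((m : ℝ≥0∞) ^ expo232 0 b 0)⁻¹ * mzvTail (Fin.tail (expo232 0 b)) m]
    refine tsum_congr fun m => ?_
    rw [htail]
    simp [midTwos, expo232]
  | succ a ih =>
    have htail (m : ℕ) : mzvTail (Fin.tail (expo232 (a + 1) b)) m = mzvTail (expo232 a b) m :=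
      mzvTail_congr (by lia) (fun i => by simp [expo232, Fin.tail]) m
    rw [mzvTail_succ, tsum_nat_add_eq N fun m =>
      ((m : ℝ≥0∞) ^ expo232 (a + 1) b 0)⁻¹ * mzvTail (Fin.tail (expo232 (a + 1) b)) m]
    simp only [htail, ih, midTwos, ← ENNReal.tsum_mul_left, ← ENNReal.tsum_mul_right]
    rw [ENNReal.tsum_comm]
    refine tsum_congr fun l => ?_
    split_ifs with h
    · refine tsum_congr fun m => ?_
      simp [expo232, mul_assoc]
    · simp

lemma Hmzv_eq (a b : ℕ) : Hmzv a b = 2 / π * ∫ x in (0 : ℝ)..(π / 2),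
    betaWeightDivSin (2 * a + 1) (2 * b + 1) x * cos x := by
  have h := hasSum_headTwos_mul_tailTwos a b
  have hnn (n : ℕ) : 0 ≤ headTwos a n * tailTwos b (n + 1) / ((n : ℝ) + 1) ^ 3 :=
    div_nonneg (mul_nonneg (headTwos_nonneg _ _) (tailTwos_nonneg _ _)) (by positivity)
  rw [← h.tsum_eq, Hmzv, mzv_eq_toReal_mzvTail, mzvTail_expo232,
    tsum_eq_zero_add' ENNReal.summable, midTwos_self_zero, zero_mul, zero_add,
    ← ENNReal.toReal_ofReal (tsum_nonneg hnn), ENNReal.ofReal_tsum_of_nonneg hnn h.summable]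
  congr 1
  refine tsum_congr fun n => ?_
  rw [midTwos_zero_eq, inv_pow_natCast_succ, ← ENNReal.ofReal_mul (by positivity),
    ← ENNReal.ofReal_mul (headTwos_nonneg _ _)]
  congr 1
  ring

lemma HmzvN_eq (n : ℕ) : HmzvN n = π ^ (2 * n) / (2 * n + 1).factorial := by
  rw [HmzvN, mzv_eq_toReal_mzvTail, mzvTail_twos, ENNReal.toReal_ofReal (tailTwos_nonneg _ _),
    tailTwos_zero_right]

theorem zagier_formula (a b K : ℕ) (hK : K = a + b + 1) :
    Hmzv a b = 2 * ∑ r ∈ Finset.Icc 1 K, (-1 : ℝ)^r *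
        (((2*r).choose (2*a+2) : ℝ) * zeta (2*r+1)
          + ((2*r).choose (2*b+1) : ℝ) * zetaA (2*r+1)) * HmzvN (K-r) := by
  subst hK
  rw [Hmzv_eq, integral_betaWeightDivSin_mul_cos, mul_sum, mul_sum]
  refine sum_congr rfl fun r _ => ?_
  rw [HmzvN_eq]
  field_simp
  ring
end
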